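/- As n → ∞, the rectangular partition function satisfies p(2,n) ~ (π·2^{1/4}/32)·n^{-7/4}·exp(π√(2n)); that is, the ratio p(2,n) / ((π·2^{1/4}/32)·n^{-7/4}·exp(π√(2n))) tends to 1 as n → ∞. -/

import Mathlib

/-- A rectangle with integer corners: `(a, b, c, d)` represents `[a,b] × [c,d] ⊆ ℝ²`
(with `a < b`, `c < d` required in `IsTiling`). -/
abbrev Rect : Type := ℕ × ℕ × ℕ × ℕ

/-- The unit cell `[i,i+1] × [j,j+1]` lies inside the rectangle `R`. -/
def cellIn (R : Rect) (i j : ℕ) : Prop :=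
  R.1 ≤ i ∧ i < R.2.1 ∧ R.2.2.1 ≤ j ∧ j < R.2.2.2

/-- `T` is a tiling of `[0,m] × [0,n]`: each rectangle has positive integer side lengths
and lies inside `[0,m] × [0,n]`, and every unit cell of `[0,m] × [0,n]` is covered by
exactly one rectangle of `T` (equivalently, the rectangles have pairwise disjoint
interiors and their union is `[0,m] × [0,n]`). -/
def IsTiling (m n : ℕ) (T : Finset Rect) : Prop :=
  (∀ R ∈ T, R.1 < R.2.1 ∧ R.2.1 ≤ m ∧ R.2.2.1 < R.2.2.2 ∧ R.2.2.2 ≤ n) ∧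
  ∀ i < m, ∀ j < n, ∃! R, R ∈ T ∧ cellIn R i j

/-- The block of a rectangle: the unordered pair of its side lengths,
recorded as a sorted pair `(min, max)`. -/
def blockOf (R : Rect) : ℕ × ℕ :=
  (min (R.2.1 - R.1) (R.2.2.2 - R.2.2.1), max (R.2.1 - R.1) (R.2.2.2 - R.2.2.1))

/-- The block multiset of a tiling. -/
def blocksOf (T : Finset Rect) : Multiset (ℕ × ℕ) := T.val.map blockOf

/-- The number of distinct block multisets of tilings of `[0,m] × [0,n]` all of whose
blocks satisfy the predicate `allowed` (as sorted pairs of side lengths). -/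
noncomputable def rectPA (m n : ℕ) (allowed : ℕ × ℕ → Prop) : ℕ :=
  Nat.card {M : Multiset (ℕ × ℕ) |
    ∃ T : Finset Rect, IsTiling m n T ∧ blocksOf T = M ∧ ∀ b ∈ M, allowed b}

/-- The rectangular partition function `p(m,n)`: the number of distinct block multisets
of tilings of `[0,m] × [0,n]`. -/
noncomputable def rectP (m n : ℕ) : ℕ :=
  Nat.card {M : Multiset (ℕ × ℕ) | ∃ T : Finset Rect, IsTiling m n T ∧ blocksOf T = M}

/-- The Euler partition function `p(n)`. -/
def eulerP (n : ℕ) : ℕ := Fintype.card (Nat.Partition n)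

/-- `p_{k,l}(2,n)`: the number of distinct block multisets of tilings of `[0,2] × [0,n]`
using only blocks with side lengths `{1,i}` for `1 ≤ i ≤ k` or `{2,j}` for `2 ≤ j ≤ l`. -/
noncomputable def pkl (k l n : ℕ) : ℕ :=
  rectPA 2 n (fun b => (b.1 = 1 ∧ 1 ≤ b.2 ∧ b.2 ≤ k) ∨ (b.1 = 2 ∧ 2 ≤ b.2 ∧ b.2 ≤ l))

open Filter Topology MeasureTheory
open scoped Real

/-- Splitting off the multiplicity of `a` from a multiset supported on `insert a B`. -/
def multisetInsertEquiv {Ω : Type*} [DecidableEq Ω] (a : Ω) (B : Finset Ω) (ha : a ∉ B) :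
    {M : Multiset Ω // ∀ b ∈ M, b ∈ B} × ℕ ≃ {M : Multiset Ω // ∀ b ∈ M, b ∈ insert a B} where
  toFun p := ⟨p.1.1 + Multiset.replicate p.2 a, by
    intro b hb
    rcases Multiset.mem_add.1 hb with h | h
    · exact Finset.mem_insert_of_mem (p.1.2 b h)
    · rw [Multiset.eq_of_mem_replicate h]; exact Finset.mem_insert_self a B⟩
  invFun M := (⟨M.1.filter (fun b => b ≠ a), by
    intro b hb
    rw [Multiset.mem_filter] at hb
    exact (Finset.mem_insert.1 (M.2 b hb.1)).resolve_left hb.2⟩, M.1.count a)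
  left_inv := by
    rintro ⟨⟨M, hM⟩, j⟩
    have h1 : ∀ b ∈ M, b ≠ a := fun b hb h => ha (h ▸ hM b hb)
    have h2 : M.count a = 0 := Multiset.count_eq_zero.2 fun h => h1 a h rfl
    have h3 : (Multiset.replicate j a).filter (fun b => b ≠ a) = 0 :=
      Multiset.filter_eq_nil.2 fun b hb => by simp [Multiset.eq_of_mem_replicate hb]
    ext1
    · ext1
      simp only [Multiset.filter_add, Multiset.filter_eq_self.2 h1, h3, add_zero]
    · simp [h2]
  right_inv := by
    rintro ⟨M, hM⟩
    ext1
    simp only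
    ext b
    by_cases h : b = a
    · subst h; simp
    · simp [Multiset.count_replicate, h, Ne.symm h]

theorem norm_multiset_prod_map {Ω 𝕜 : Type*} [RCLike 𝕜] (w : Ω → 𝕜) (M : Multiset Ω) :
    ‖(M.map w).prod‖ = (M.map fun b => ‖w b‖).prod := by
  induction M using Multiset.induction_on with
  | empty => simp
  | cons a M ih => simp [ih]

theorem hasSum_multiset_finset {Ω 𝕜 : Type*} [DecidableEq Ω] [RCLike 𝕜] (w : Ω → 𝕜)
    (hw : ∀ b, ‖w b‖ < 1) (B : Finset Ω) :
    HasSum (fun M : {M : Multiset Ω // ∀ b ∈ M, b ∈ B} => (M.1.map w).prod)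
      (∏ b ∈ B, (1 - w b)⁻¹) := by
  induction B using Finset.induction_on with
  | empty =>
    have h := hasSum_single (f := fun M : {M : Multiset Ω // ∀ b ∈ M, b ∈ (∅ : Finset Ω)} =>
      (M.1.map w).prod) ⟨0, by simp⟩ fun M hM => (hM (Subtype.ext
        (Multiset.eq_zero_of_forall_notMem fun b hb => by simpa using M.2 b hb))).elim
    simpa using h
  | insert a B ha ih =>
    rw [Finset.prod_insert ha, mul_comm, ← (multisetInsertEquiv a B ha).hasSum_iff]
    have hg := hasSum_geometric_of_norm_lt_one (hw a)
    have hn1 := ih.summable.norm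
    have hn2 := hg.summable.norm
    have hm := summable_mul_of_summable_norm hn1 hn2
    have h := ih.mul hg hm
    have he : (fun M : {M : Multiset Ω // ∀ b ∈ M, b ∈ insert a B} => (M.1.map w).prod) ∘
        multisetInsertEquiv a B ha = fun p => (p.1.1.map w).prod * w a ^ p.2 := by
      funext p
      simp [multisetInsertEquiv]
    rw [he]
    exact h

theorem hasProd_multiset {Ω 𝕜 : Type*} [RCLike 𝕜] (w : Ω → 𝕜)
    (hw : ∀ b, ‖w b‖ < 1) (hs : Summable (fun b => ‖w b‖)) :
    Summable (fun M : Multiset Ω => ‖(M.map w).prod‖) ∧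
    HasProd (fun b => (1 - w b)⁻¹) (∑' M : Multiset Ω, (M.map w).prod) := by
  classical
  have hsum : Summable (fun M : Multiset Ω => ‖(M.map w).prod‖) := by
    have hm : Multipliable (fun b => (1 - ‖w b‖)⁻¹) := by
      have h1 : Multipliable (fun b => 1 + -‖w b‖) :=
        Real.multipliable_one_add_of_summable (by simpa using hs.neg)
      have h2 := tprod_one_add_ne_zero_of_summable (f := fun b => -‖w b‖)
        (fun b => by linarith [hw b]) (by simpa using hs)
      exact h1.inv₀ h2
    obtain ⟨C, hC⟩ := hm
    have hmono : Monotone (fun B : Finset Ω => ∏ b ∈ B, (1 - ‖w b‖)⁻¹) := by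
      intro B B' hBB
      simp only
      rw [← Finset.prod_sdiff hBB]
      refine le_mul_of_one_le_left (Finset.prod_nonneg fun b _ => ?_) ?_
      · have := hw b
        exact inv_nonneg.2 (by linarith)
      · refine (Finset.prod_const_one (s := B' \ B)).symm.le.trans
          (Finset.prod_le_prod (fun _ _ => zero_le_one) fun b _ => ?_)
        exact (one_le_inv₀ (by linarith [hw b])).2 (by linarith [norm_nonneg (w b)])
    refine summable_of_sum_le (c := C) (fun _ => norm_nonneg _) fun u => ?_
    let B : Finset Ω := u.biUnion Multiset.toFinset
    have hB := hasSum_multiset_finset (fun b => ‖w b‖) (by simpa using hw) B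
    have h1 : ∑ M ∈ u, ‖(M.map w).prod‖ ≤ ∏ b ∈ B, (1 - ‖w b‖)⁻¹ := by
      let v : Finset {M : Multiset Ω // ∀ b ∈ M, b ∈ B} := u.subtype _
      have hv := sum_le_hasSum v (fun M _ => by
        refine Multiset.prod_nonneg fun x hx => ?_
        obtain ⟨b, -, rfl⟩ := Multiset.mem_map.1 hx
        exact norm_nonneg _) hB
      refine le_trans (le_of_eq ?_) hv
      rw [Finset.sum_subtype_of_mem (f := fun M : Multiset Ω => (M.map fun b => ‖w b‖).prod)]
      · refine Finset.sum_congr rfl fun M _ => ?_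
        exact norm_multiset_prod_map w M
      · intro M hM b hb
        exact Finset.mem_biUnion.2 ⟨M, hM, Multiset.mem_toFinset.2 hb⟩
    exact h1.trans (hmono.ge_of_tendsto hC B)
  refine ⟨hsum, ?_⟩
  have := tendsto_tsum_of_dominated_convergence (𝓕 := (atTop : Filter (Finset Ω)))
    (f := fun B M => Set.indicator {M : Multiset Ω | ∀ b ∈ M, b ∈ B} (fun M => (M.map w).prod) M)
    (g := fun M => (M.map w).prod) hsum
    (fun M => tendsto_const_nhds.congr' (by
      filter_upwards [eventually_ge_atTop M.toFinset] with B hB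
      rw [Set.indicator_of_mem]
      intro b hb
      exact hB (Multiset.mem_toFinset.2 hb)))
    (Eventually.of_forall fun B M => norm_indicator_le_norm_self _ _)
  refine this.congr fun B => ?_
  rw [← tsum_subtype]
  exact (hasSum_multiset_finset w hw B).tsum_eq

/-- The area of a block: `inl k` stands for the block `{1, k + 1}`, `inr j` for `{2, j + 2}`. -/
def blkArea : ℕ ⊕ ℕ → ℕ := Sum.elim (fun k => k + 1) (fun j => 2 * (j + 2))

/-- The number of multisets of blocks of width one or two with total area `m`. -/
noncomputable def blkCount (m : ℕ) : ℕ :=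
  Nat.card {M : Multiset (ℕ ⊕ ℕ) // (M.map blkArea).sum = m}

/-- The Euler product `∏ (1 - q ^ n)`. -/
noncomputable def eulerProd {𝕜 : Type*} [RCLike 𝕜] (q : 𝕜) : 𝕜 := ∏' n : ℕ, (1 - q ^ (n + 1))

/-- The generating function of `blkCount`. -/
noncomputable def blkGen {𝕜 : Type*} [RCLike 𝕜] (q : 𝕜) : 𝕜 :=
  (1 - q ^ 2) / (eulerProd q * eulerProd (q ^ 2))

section
variable {𝕜 : Type*} [RCLike 𝕜] {q : 𝕜}

theorem summable_norm_pow_succ (hq : ‖q‖ < 1) : Summable fun n : ℕ => ‖q ^ (n + 1)‖ := by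
  simp only [norm_pow]
  exact (summable_nat_add_iff 1).2 (summable_geometric_of_lt_one (norm_nonneg _) hq)

theorem hasProd_eulerProd (hq : ‖q‖ < 1) :
    HasProd (fun n : ℕ => 1 - q ^ (n + 1)) (eulerProd q) := by
  have h : Multipliable fun n : ℕ => 1 + -q ^ (n + 1) :=
    multipliable_one_add_of_summable (by simpa using summable_norm_pow_succ hq)
  simp only [← sub_eq_add_neg] at h
  exact h.hasProd

theorem one_sub_pow_succ_ne_zero (hq : ‖q‖ < 1) (n : ℕ) : 1 - q ^ (n + 1) ≠ 0 := by
  intro h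
  have h1 : ‖q ^ (n + 1)‖ < 1 := by
    rw [norm_pow]; exact pow_lt_one₀ (norm_nonneg _) hq n.succ_ne_zero
  rw [← sub_eq_zero.1 h, norm_one] at h1
  exact lt_irrefl _ h1

theorem eulerProd_ne_zero (hq : ‖q‖ < 1) : eulerProd q ≠ 0 := by
  have := tprod_one_add_ne_zero_of_summable (f := fun n : ℕ => -q ^ (n + 1))
    (fun n => by simpa only [← sub_eq_add_neg] using one_sub_pow_succ_ne_zero hq n)
    (by simpa using summable_norm_pow_succ hq)
  simp only [← sub_eq_add_neg] at this
  exact this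

theorem norm_sq_lt_one (hq : ‖q‖ < 1) : ‖q ^ 2‖ < 1 := by
  rw [norm_pow]; exact pow_lt_one₀ (norm_nonneg _) hq two_ne_zero

theorem hasProd_blkGen (hq : ‖q‖ < 1) :
    HasProd (fun b => (1 - q ^ blkArea b)⁻¹) (blkGen q) := by
  have hq2 := norm_sq_lt_one hq
  have h1 := (hasProd_eulerProd hq).inv₀ (eulerProd_ne_zero hq)
  have h2 : HasProd (fun j : ℕ => (1 - q ^ (2 * (j + 2)))⁻¹)
      ((1 - q ^ 2) * (eulerProd (q ^ 2))⁻¹) := by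
    have h3 : Multipliable fun j : ℕ => 1 + -(q ^ 2) ^ (j + 1 + 1) :=
      multipliable_one_add_of_summable (by
        simpa only [norm_neg] using (summable_nat_add_iff 1).2 (summable_norm_pow_succ hq2))
    simp only [← sub_eq_add_neg] at h3
    have h4 : eulerProd (q ^ 2) = (1 - q ^ 2) * ∏' j : ℕ, (1 - (q ^ 2) ^ (j + 1 + 1)) := by
      simpa using (hasProd_eulerProd hq2).unique
        (HasProd.zero_mul (f := fun n : ℕ => 1 - (q ^ 2) ^ (n + 1)) h3.hasProd)
    have h5 := eulerProd_ne_zero hq2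
    rw [h4] at h5
    have h6 := h3.hasProd.inv₀ (right_ne_zero_of_mul h5)
    have h7 : (1 - q ^ 2) * (eulerProd (q ^ 2))⁻¹ = (∏' j : ℕ, (1 - (q ^ 2) ^ (j + 1 + 1)))⁻¹ := by
      have := left_ne_zero_of_mul h5
      rw [h4, mul_inv, mul_inv_cancel_left₀ this]
    rw [h7]
    simpa only [pow_mul] using h6
  have : blkGen q = (eulerProd q)⁻¹ * ((1 - q ^ 2) * (eulerProd (q ^ 2))⁻¹) := by
    rw [blkGen]; field_simp
  rw [this]
  exact HasProd.sum h1 h2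

theorem blkArea_pos (b : ℕ ⊕ ℕ) : 0 < blkArea b := by
  rcases b with k | j <;> simp [blkArea]

theorem summable_norm_pow_blkArea (hq : ‖q‖ < 1) : Summable fun b => ‖q ^ blkArea b‖ := by
  have h2 := (summable_nat_add_iff 1).2 (summable_norm_pow_succ (norm_sq_lt_one hq))
  simp only [← pow_mul] at h2
  have h1 := (summable_norm_pow_succ hq).hasSum
  exact (HasSum.sum (f := fun b => ‖q ^ blkArea b‖) h1 h2.hasSum).summable

theorem norm_pow_blkArea_lt_one (hq : ‖q‖ < 1) (b : ℕ ⊕ ℕ) : ‖q ^ blkArea b‖ < 1 := by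
  rw [norm_pow]; exact pow_lt_one₀ (norm_nonneg _) hq (blkArea_pos b).ne'

theorem prod_map_pow {Ω : Type*} (a : Ω → ℕ) (M : Multiset Ω) :
    (M.map fun b => q ^ a b).prod = q ^ (M.map a).sum := by
  induction M using Multiset.induction_on with
  | empty => simp
  | cons c M ih => simp [ih, pow_add]

theorem finite_blk (m : ℕ) : Finite {M : Multiset (ℕ ⊕ ℕ) // (M.map blkArea).sum = m} := by
  have hq : ‖(1 / 2 : ℝ)‖ < 1 := by norm_num
  have h := (hasProd_multiset _ (norm_pow_blkArea_lt_one hq) (summable_norm_pow_blkArea hq)).1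
  have h2 := h.comp_injective
    (Subtype.val_injective (p := fun M : Multiset (ℕ ⊕ ℕ) => (M.map blkArea).sum = m))
  have h3 : Summable fun _ : {M : Multiset (ℕ ⊕ ℕ) // (M.map blkArea).sum = m} =>
      ‖((1 / 2 : ℝ)) ^ m‖ := by
    refine h2.congr fun M => ?_
    simp only [Function.comp, prod_map_pow, M.2]
  by_contra hinf
  rw [not_finite_iff_infinite] at hinf
  exact absurd (summable_const_iff _ |>.1 h3) (norm_pos_iff.2 (by positivity)).ne'

theorem hasSum_blkCount (hq : ‖q‖ < 1) : HasSum (fun m => (blkCount m : 𝕜) * q ^ m) (blkGen q) := by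
  obtain ⟨h1, h2⟩ := hasProd_multiset _ (norm_pow_blkArea_lt_one hq) (summable_norm_pow_blkArea hq)
  rw [(hasProd_blkGen hq).unique h2]
  have h3 := h1.of_norm.hasSum
  rw [← (Equiv.sigmaFiberEquiv fun M : Multiset (ℕ ⊕ ℕ) => (M.map blkArea).sum).hasSum_iff] at h3
  refine h3.sigma fun m => ?_
  have := finite_blk m
  have := Fintype.ofFinite {M : Multiset (ℕ ⊕ ℕ) // (M.map blkArea).sum = m}
  have h4 := hasSum_fintype fun _ : {M : Multiset (ℕ ⊕ ℕ) // (M.map blkArea).sum = m} => q ^ m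
  rw [Finset.sum_const, nsmul_eq_mul, Finset.card_univ, ← Nat.card_eq_fintype_card] at h4
  refine h4.congr_fun fun M => ?_
  simp [prod_map_pow, M.2]

end

theorem eulerProd_ofReal {r : ℝ} (hr : |r| < 1) : eulerProd (r : ℂ) = (eulerProd r : ℝ) := by
  have h := (hasProd_eulerProd (q := r) hr).map Complex.ofRealHom Complex.continuous_ofReal
  refine (hasProd_eulerProd (q := (r : ℂ)) (by simpa using hr)).unique ?_
  refine h.congr_fun fun n => by simp

theorem blkGen_ofReal {r : ℝ} (hr : |r| < 1) : blkGen (r : ℂ) = (blkGen r : ℝ) := by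
  have := eulerProd_ofReal (r := r ^ 2) (by
    rw [abs_pow]; exact pow_lt_one₀ (abs_nonneg _) hr two_ne_zero)
  push_cast at this
  simp [blkGen, eulerProd_ofReal hr, this]

theorem eulerProd_pos {r : ℝ} (h0 : 0 ≤ r) (h1 : r < 1) : 0 < eulerProd r := by
  have hr : ‖r‖ < 1 := by rwa [Real.norm_of_nonneg h0]
  refine lt_of_le_of_ne ?_ (eulerProd_ne_zero hr).symm
  refine ge_of_tendsto (hasProd_eulerProd hr) (Eventually.of_forall fun B => ?_)
  refine Finset.prod_nonneg fun n _ => ?_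
  have := pow_le_one₀ (n := n + 1) h0 h1.le
  linarith

theorem blkGen_pos {r : ℝ} (h0 : 0 ≤ r) (h1 : r < 1) : 0 < blkGen r := by
  have h2 : r ^ 2 < 1 := pow_lt_one₀ h0 h1 two_ne_zero
  exact div_pos (by linarith) (mul_pos (eulerProd_pos h0 h1) (eulerProd_pos (sq_nonneg r) h2))

theorem eta_eq_eulerProd (s : ℂ) :
    ModularForm.eta (Complex.I * s / (2 * π)) =
      Complex.exp (-s / 24) * eulerProd (Complex.exp (-s)) := by
  have hpi : (π : ℂ) ≠ 0 := by exact_mod_cast Real.pi_ne_zero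
  have h1 : 2 * π * Complex.I * (Complex.I * s / (2 * π)) = -s := by
    field_simp
    rw [Complex.I_sq]; ring
  simp only [ModularForm.eta, ModularForm.eta_q, Function.Periodic.qParam, eulerProd]
  rw [h1]
  norm_num

theorem eulerProd_transform {s : ℂ} (hs : 0 < s.re) :
    Complex.exp (-(4 * π ^ 2 / s) / 24) * eulerProd (Complex.exp (-(4 * π ^ 2 / s))) =
      (Complex.sqrt Complex.I)⁻¹ * (Complex.sqrt (Complex.I * s / (2 * π)) *
        (Complex.exp (-s / 24) * eulerProd (Complex.exp (-s)))) := by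
  have hpi : (π : ℂ) ≠ 0 := by exact_mod_cast Real.pi_ne_zero
  have hs0 : s ≠ 0 := by rintro rfl; simp at hs
  have hz : (Complex.I * s / (2 * π)) ∈ UpperHalfPlane.upperHalfPlaneSet := by
    have : Complex.I * s / (2 * π) = Complex.I * s / ((2 * π : ℝ) : ℂ) := by push_cast; rfl
    change 0 < (Complex.I * s / (2 * π)).im
    rw [this, Complex.div_ofReal_im]
    simp
    positivity
  have h := ModularForm.eta_comp_eq_csqrt_I_inv hz
  have h2 : -1 / (Complex.I * s / (2 * π)) = Complex.I * (4 * π ^ 2 / s) / (2 * π) := by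
    field_simp
    rw [Complex.I_sq]; ring
  simp only [Function.comp, Pi.smul_apply, Pi.mul_apply, smul_eq_mul] at h
  rwa [h2, eta_eq_eulerProd, eta_eq_eulerProd] at h

theorem norm_exp_neg_lt_one {s : ℂ} (hs : 0 < s.re) : ‖Complex.exp (-s)‖ < 1 := by
  rw [Complex.norm_exp]; simpa using hs

theorem csqrt_mul_self (z : ℂ) : Complex.sqrt z * Complex.sqrt z = z := by
  rcases eq_or_ne z 0 with rfl | hz
  · simp [Complex.sqrt]
  · rw [Complex.sqrt, ← Complex.cpow_add _ _ hz]; norm_num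

theorem csqrt_ofReal_mul {a : ℝ} (ha : 0 < a) {z : ℂ} (hz : z ≠ 0) :
    Complex.sqrt (a * z) = Real.sqrt a * Complex.sqrt z := by
  have ha0 : (a : ℂ) ≠ 0 := by exact_mod_cast ha.ne'
  rw [Complex.sqrt, Complex.sqrt, Real.sqrt_eq_rpow, Complex.ofReal_cpow ha.le,
    Complex.cpow_def_of_ne_zero (mul_ne_zero ha0 hz), Complex.log_ofReal_mul ha hz,
    Complex.cpow_def_of_ne_zero ha0, Complex.cpow_def_of_ne_zero hz, ← Complex.exp_add,
    ← Complex.ofReal_log ha.le]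
  congr 1; push_cast; ring

theorem blkGen_transform {s : ℂ} (hs : 0 < s.re) :
    blkGen (Complex.exp (-s)) = (1 - Complex.exp (-(2 * s))) * ((Real.sqrt 2 : ℂ) * s / (2 * π)) *
      Complex.exp (-s / 8) * Complex.exp (π ^ 2 / 4 / s) /
      (eulerProd (Complex.exp (-(4 * π ^ 2 / s))) *
        eulerProd (Complex.exp (-(2 * π ^ 2 / s)))) := by
  have hpi : (π : ℂ) ≠ 0 := by exact_mod_cast Real.pi_ne_zero
  have hs0 : s ≠ 0 := by rintro rfl; simp at hs
  have hs2 : 0 < (2 * s).re := by simpa using hs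
  have h1 := eulerProd_transform hs
  have h2 := eulerProd_transform hs2
  have hinv : 0 < (s⁻¹).re := by
    rw [Complex.inv_re]; exact div_pos hs (Complex.normSq_pos.2 hs0)
  have e1 : eulerProd (Complex.exp (-(4 * π ^ 2 / s))) ≠ 0 := by
    refine eulerProd_ne_zero (norm_exp_neg_lt_one ?_)
    have : (4 * π ^ 2 / s : ℂ) = ((4 * π ^ 2 : ℝ) : ℂ) * s⁻¹ := by push_cast; rfl
    rw [this, Complex.re_ofReal_mul]; positivity
  have e2 : eulerProd (Complex.exp (-(2 * π ^ 2 / s))) ≠ 0 := by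
    refine eulerProd_ne_zero (norm_exp_neg_lt_one ?_)
    have : (2 * π ^ 2 / s : ℂ) = ((2 * π ^ 2 : ℝ) : ℂ) * s⁻¹ := by push_cast; rfl
    rw [this, Complex.re_ofReal_mul]; positivity
  have e3 := eulerProd_ne_zero (norm_exp_neg_lt_one hs)
  have e4 := eulerProd_ne_zero (norm_exp_neg_lt_one hs2)
  have hq : (4 * π ^ 2 / (2 * s) : ℂ) = 2 * π ^ 2 / s := by field_simp; ring
  rw [hq] at h2
  have hsq : Complex.exp (-s) ^ 2 = Complex.exp (-(2 * s)) := by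
    rw [← Complex.exp_nat_mul]; congr 1; push_cast; ring
  have hI : (Complex.sqrt Complex.I)⁻¹ * (Complex.sqrt Complex.I)⁻¹ = -Complex.I := by
    rw [← mul_inv, csqrt_mul_self, Complex.inv_I]
  have hS : Complex.sqrt (Complex.I * s / (2 * π)) * Complex.sqrt (Complex.I * (2 * s) / (2 * π)) =
      (Real.sqrt 2 : ℂ) * (Complex.I * s / (2 * π)) := by
    have h3 : Complex.I * (2 * s) / (2 * π) = ((2 : ℝ) : ℂ) * (Complex.I * s / (2 * π)) := by
      push_cast; ring
    rw [h3, csqrt_ofReal_mul (by norm_num) (by simp [hs0, hpi]), ← mul_assoc,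
      mul_comm (Complex.sqrt _), mul_assoc,
      csqrt_mul_self]
  have hA : Complex.exp (-(4 * π ^ 2 / s) / 24) * Complex.exp (-(2 * π ^ 2 / s) / 24) *
      Complex.exp (π ^ 2 / 4 / s) = 1 := by
    rw [← Complex.exp_add, ← Complex.exp_add, ← Complex.exp_zero]
    congr 1; field_simp; ring
  have hB : Complex.exp (-s / 24) * Complex.exp (-(2 * s) / 24) = Complex.exp (-s / 8) := by
    rw [← Complex.exp_add]; congr 1; ring
  have hmul := congrArg₂ (· * ·) h1 h2
  rw [blkGen, hsq, div_eq_div_iff (mul_ne_zero e3 e4) (mul_ne_zero e1 e2)]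
  generalize eulerProd (Complex.exp (-(4 * π ^ 2 / s))) = X at *
  generalize eulerProd (Complex.exp (-(2 * π ^ 2 / s))) = Y at *
  generalize eulerProd (Complex.exp (-s)) = P at *
  generalize eulerProd (Complex.exp (-(2 * s))) = Q at *
  generalize Complex.exp (-(4 * π ^ 2 / s) / 24) = A at *
  generalize Complex.exp (-(2 * π ^ 2 / s) / 24) = A2 at *
  generalize Complex.exp (π ^ 2 / 4 / s) = D at *
  rw [← hB]
  generalize Complex.exp (-s / 24) = B1 at *
  generalize Complex.exp (-(2 * s) / 24) = B2 at *
  generalize Complex.sqrt (Complex.I * s / (2 * π)) = S1 at *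
  generalize Complex.sqrt (Complex.I * (2 * s) / (2 * π)) = S2 at *
  generalize (Complex.sqrt Complex.I)⁻¹ = J at *
  have key : A * A2 * (X * Y) = (Real.sqrt 2 : ℂ) * s / (2 * π) * (B1 * B2) * (P * Q) := by
    have : A * A2 * (X * Y) = (J * J) * (S1 * S2) * (B1 * B2) * (P * Q) := by
      linear_combination hmul
    rw [this, hI, hS]
    linear_combination (-(Real.sqrt 2 : ℂ) * s / (2 * π) * (B1 * B2) * (P * Q)) * Complex.I_sq
  have key2 : X * Y = D * ((Real.sqrt 2 : ℂ) * s / (2 * π) * (B1 * B2) * (P * Q)) := by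
    rw [← key]
    linear_combination (-(X * Y)) * hA
  rw [key2]
  ring

theorem one_sub_mul_exp_le {w : ℂ} (hw : ‖w‖ < 1) :
    (1 - ‖w‖) * Real.exp ‖w‖ ≤ ‖1 - w‖ * Real.exp w.re := by
  have hw0 : 0 < 1 - ‖w‖ := by linarith
  have hne : 0 < ‖1 - w‖ := norm_pos_iff.2 fun h => by
    rw [← sub_eq_zero.1 h, norm_one] at hw; exact lt_irrefl _ hw
  have h1 := Complex.hasSum_re (Complex.hasSum_taylorSeries_neg_log hw)
  have h2 := Complex.hasSum_re
    (Complex.hasSum_taylorSeries_neg_log (z := ((‖w‖ : ℝ) : ℂ)) (by simpa using hw))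
  have h3 := h2.sub h1
  have h4 := le_hasSum h3 1 fun n _ => by
    have e1 : (((‖w‖ : ℝ) : ℂ) ^ n / n).re = ‖w‖ ^ n / n := by
      rw [← Complex.ofReal_pow, ← Complex.ofReal_natCast, ← Complex.ofReal_div, Complex.ofReal_re]
    have e2 : (w ^ n / n).re ≤ ‖w‖ ^ n / n := by
      refine (Complex.re_le_norm _).trans (le_of_eq ?_)
      simp
    linarith
  have e3 : (1 - ((‖w‖ : ℝ) : ℂ)) = ((1 - ‖w‖ : ℝ) : ℂ) := by push_cast; rfl
  simp only [pow_one, Nat.cast_one, div_one, Complex.ofReal_re, Complex.neg_re, Complex.log_re,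
    e3, Complex.norm_real, Real.norm_of_nonneg hw0.le] at h4
  have h5 : Real.log (1 - ‖w‖) + ‖w‖ ≤ Real.log ‖1 - w‖ + w.re := by linarith
  have h6 := Real.exp_le_exp.2 h5
  rwa [Real.exp_add, Real.exp_add, Real.exp_log hw0, Real.exp_log hne] at h6

theorem eulerProd_mul_exp_le {q : ℂ} (hq : ‖q‖ < 1) :
    eulerProd ‖q‖ * Real.exp (1 / (1 - ‖q‖)) ≤ ‖eulerProd q‖ * Real.exp (1 / ‖1 - q‖) := by
  have hr : ‖‖q‖‖ < 1 := by simpa using hq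
  have a1 := (hasProd_eulerProd hr).tendsto_prod_nat
  have a2 := ((hasSum_geometric_of_norm_lt_one hr).mul_left ‖q‖).tendsto_sum_nat
  have b1 := (hasProd_eulerProd hq).tendsto_prod_nat.norm
  have b2 := (Complex.hasSum_re ((hasSum_geometric_of_norm_lt_one hq).mul_left q)).tendsto_sum_nat
  have h := le_of_tendsto_of_tendsto' (a1.mul (Real.continuous_exp.tendsto _ |>.comp a2))
    (b1.mul (Real.continuous_exp.tendsto _ |>.comp b2)) fun n => by
      simp only [Function.comp, Real.exp_sum, norm_prod]
      rw [← Finset.prod_mul_distrib, ← Finset.prod_mul_distrib]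
      refine Finset.prod_le_prod (fun k _ => ?_) fun k _ => ?_
      · have : ‖q‖ ^ (k + 1) ≤ 1 := pow_le_one₀ (norm_nonneg _) hq.le
        exact mul_nonneg (by linarith) (Real.exp_pos _).le
      · have hk : ‖q ^ (k + 1)‖ < 1 := by
          rw [norm_pow]; exact pow_lt_one₀ (norm_nonneg _) hq k.succ_ne_zero
        have h := one_sub_mul_exp_le hk
        rw [norm_pow] at h
        rwa [← pow_succ', ← pow_succ']
  have hne : 1 - q ≠ 0 := by simpa using one_sub_pow_succ_ne_zero hq 0
  have hne' : 1 - ‖q‖ ≠ 0 := by linarith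
  have e1 : ‖q‖ * (1 - ‖q‖)⁻¹ = 1 / (1 - ‖q‖) - 1 := by field_simp; ring
  have e2 : q * (1 - q)⁻¹ = (1 - q)⁻¹ - 1 := by field_simp; ring
  have e3 : (q * (1 - q)⁻¹).re ≤ 1 / ‖1 - q‖ - 1 := by
    rw [e2, Complex.sub_re, Complex.one_re, one_div, ← norm_inv]
    linarith [Complex.re_le_norm (1 - q)⁻¹]
  rw [e1, Real.exp_sub] at h
  have h2 := h.trans (mul_le_mul_of_nonneg_left (Real.exp_le_exp.2 e3) (norm_nonneg _))
  rw [Real.exp_sub, ← mul_div_assoc, ← mul_div_assoc] at h2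
  exact (div_le_div_iff_of_pos_right (Real.exp_pos 1)).1 h2

theorem eulerProd_le_norm {q : ℂ} {r : ℝ} (hq : ‖q‖ ≤ r) (hr : r < 1) :
    eulerProd r ≤ ‖eulerProd q‖ := by
  have h0 := (norm_nonneg q).trans hq
  have a1 := (hasProd_eulerProd (q := r) (by rwa [Real.norm_of_nonneg h0])).tendsto_prod_nat
  have b1 := (hasProd_eulerProd (hq.trans_lt hr)).tendsto_prod_nat.norm
  refine le_of_tendsto_of_tendsto' a1 b1 fun n => ?_
  rw [norm_prod]
  refine Finset.prod_le_prod (fun k _ => ?_) fun k _ => ?_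
  · have : r ^ (k + 1) ≤ 1 := pow_le_one₀ h0 hr.le
    linarith
  · have h1 : ‖q ^ (k + 1)‖ ≤ r ^ (k + 1) := by
      rw [norm_pow]; exact pow_le_pow_left₀ (norm_nonneg _) hq _
    have h2 := norm_sub_norm_le 1 (q ^ (k + 1))
    rw [norm_one] at h2
    linarith

theorem tendsto_eulerProd_zero : Tendsto (eulerProd : ℂ → ℂ) (𝓝 0) (𝓝 1) := by
  have h := (ModularForm.differentiableOn_tprod_one_sub_pow.differentiableAt
    (Metric.isOpen_ball.mem_nhds (Metric.mem_ball_self one_pos))).continuousAt.tendsto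
  have h0 : ∏' n : ℕ, (1 - (0 : ℂ) ^ (n + 1)) = 1 := by simp
  rwa [h0] at h

theorem re_inv_ge {s : ℂ} (hs : 0 < s.re) (him : |s.im| ≤ s.re) : 1 / (2 * s.re) ≤ (1 / s).re := by
  have h1 : 0 < Complex.normSq s := Complex.normSq_pos.2 (by rintro rfl; simp at hs)
  have h2 : s.im * s.im ≤ s.re * s.re := by
    have := abs_le.1 him
    nlinarith
  rw [one_div s, Complex.inv_re, div_le_div_iff₀ (by positivity) h1, Complex.normSq_apply]
  nlinarith

theorem norm_exp_neg_div_le {s : ℂ} (hs : 0 < s.re) (him : |s.im| ≤ s.re) {a : ℝ} (ha : 0 ≤ a) :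
    ‖Complex.exp (-(a / s))‖ ≤ Real.exp (-(a / (2 * s.re))) := by
  rw [Complex.norm_exp, Real.exp_le_exp, Complex.neg_re, neg_le_neg_iff]
  have : (a / s : ℂ) = (a : ℂ) * (1 / s) := by ring
  rw [this, Complex.re_ofReal_mul, div_eq_mul_one_div]
  exact mul_le_mul_of_nonneg_left (re_inv_ge hs him) ha

theorem exists_norm_blkGen_le : ∃ C : ℝ, 0 < C ∧ ∀ s : ℂ, 0 < s.re → s.re ≤ 1 / 4 →
    |s.im| ≤ s.re → ‖blkGen (Complex.exp (-s))‖ ≤ C * s.re ^ 2 * Real.exp ((π ^ 2 / 4 / s).re) := by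
  have hc : 0 < eulerProd (1 / 2 : ℝ) := eulerProd_pos (by norm_num) (by norm_num)
  have hpi := Real.pi_gt_three
  refine ⟨8 * (Real.sqrt 2 * 2 / (2 * π)) / (eulerProd (1 / 2 : ℝ) * eulerProd (1 / 2 : ℝ)),
    by positivity, fun s hs hs4 him => ?_⟩
  have hE : ∀ a : ℝ, 2 ≤ a → eulerProd (1 / 2 : ℝ) ≤ ‖eulerProd (Complex.exp (-(a / s)))‖ := by
    intro a ha
    refine eulerProd_le_norm ((norm_exp_neg_div_le hs him (by linarith)).trans ?_) (by norm_num)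
    have h1 : 1 ≤ a / (2 * s.re) := by rw [le_div_iff₀ (by positivity)]; linarith
    rw [Real.exp_neg, one_div]
    refine inv_anti₀ two_pos ?_
    linarith [Real.add_one_le_exp (a / (2 * s.re))]
  have hn : ‖s‖ ≤ 2 * s.re := by
    have := Complex.norm_le_abs_re_add_abs_im s
    rw [abs_of_pos hs] at this; linarith
  have h1 : ‖1 - Complex.exp (-(2 * s))‖ ≤ 8 * s.re := by
    have h2 : ‖-(2 * s)‖ = 2 * ‖s‖ := by simp
    have := Complex.norm_exp_sub_one_le (x := -(2 * s)) (by rw [h2]; linarith)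
    rw [norm_sub_rev]
    linarith
  have h2 : ‖(Real.sqrt 2 : ℂ) * s / (2 * π)‖ ≤ Real.sqrt 2 * 2 / (2 * π) * s.re := by
    rw [norm_div, norm_mul, norm_mul, Complex.norm_real, Complex.norm_real,
      Real.norm_of_nonneg (Real.sqrt_nonneg 2), Real.norm_of_nonneg Real.pi_pos.le]
    simp only [Complex.norm_ofNat]
    rw [div_mul_eq_mul_div, mul_assoc √2]
    exact div_le_div_of_nonneg_right (mul_le_mul_of_nonneg_left hn (Real.sqrt_nonneg 2))
      (by positivity)
  have h3 : ‖Complex.exp (-s / 8)‖ ≤ 1 := by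
    rw [Complex.norm_exp, Real.exp_le_one_iff]
    have : (-s / 8).re = -s.re / 8 := by simp
    linarith
  have h4 := hE (4 * π ^ 2) (by nlinarith)
  have h5 := hE (2 * π ^ 2) (by nlinarith)
  push_cast at h4 h5
  rw [blkGen_transform hs, norm_div, norm_mul, norm_mul, norm_mul, norm_mul,
    Complex.norm_exp (_ / s)]
  calc _ ≤ (8 * s.re) * (Real.sqrt 2 * 2 / (2 * π) * s.re) * 1 * Real.exp ((π ^ 2 / 4 / s).re) /
        (eulerProd (1 / 2 : ℝ) * eulerProd (1 / 2 : ℝ)) := by gcongr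
    _ = _ := by ring

theorem continuousOn_blkGen : ContinuousOn (blkGen : ℂ → ℂ) (Metric.ball 0 1) := by
  have h : ContinuousOn (eulerProd : ℂ → ℂ) (Metric.ball 0 1) :=
    ModularForm.differentiableOn_tprod_one_sub_pow.continuousOn
  have h1 : ∀ q ∈ Metric.ball (0 : ℂ) 1, ‖q‖ < 1 := fun q hq => mem_ball_zero_iff.1 hq
  have h2 : Set.MapsTo (fun q : ℂ => q ^ 2) (Metric.ball 0 1) (Metric.ball 0 1) := fun q hq =>
    mem_ball_zero_iff.2 (norm_sq_lt_one (h1 q hq))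
  exact ContinuousOn.div (by fun_prop) (h.mul (h.comp (by fun_prop) h2)) fun q hq =>
    mul_ne_zero (eulerProd_ne_zero (h1 q hq)) (eulerProd_ne_zero (norm_sq_lt_one (h1 q hq)))

/-- The integrand of the circle method, on the line of abscissa `σ`. -/
noncomputable def blkIntegrand (m : ℕ) (σ θ : ℝ) : ℂ :=
  blkGen (Complex.exp (-(σ + θ * Complex.I))) * Complex.exp (m * (σ + θ * Complex.I))

theorem continuous_blkIntegrand (m : ℕ) {σ : ℝ} (hσ : 0 < σ) : Continuous (blkIntegrand m σ) := by
  refine Continuous.mul ?_ (by fun_prop)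
  refine continuousOn_blkGen.comp_continuous (by fun_prop) fun θ => ?_
  exact mem_ball_zero_iff.2 (norm_exp_neg_lt_one (by simpa using hσ))

theorem integral_exp_int_mul (k : ℤ) :
    ∫ θ in -π..π, Complex.exp (k * (θ * Complex.I)) = if k = 0 then 2 * (π : ℂ) else 0 := by
  split_ifs with hk
  · simp [hk]; ring
  · have hc : (k : ℂ) * Complex.I ≠ 0 := mul_ne_zero (by exact_mod_cast hk) Complex.I_ne_zero
    have e : ∀ θ : ℝ, (k : ℂ) * (θ * Complex.I) = k * Complex.I * θ := fun θ => by ring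
    simp only [e]
    rw [integral_exp_mul_complex hc, div_eq_zero_iff]
    refine Or.inl (sub_eq_zero.2 (Complex.exp_eq_exp_iff_exists_int.2 ⟨k, ?_⟩))
    push_cast; ring

theorem integral_blkIntegrand (m : ℕ) {σ : ℝ} (hσ : 0 < σ) :
    ∫ θ in -π..π, blkIntegrand m σ θ = 2 * π * blkCount m := by
  have key : ∀ θ : ℝ, HasSum (fun k : ℕ => (blkCount k : ℂ) *
      (Complex.exp (((m : ℝ) - k) * σ) * Complex.exp (((m - k : ℤ) : ℂ) * (θ * Complex.I))))
      (blkIntegrand m σ θ) := fun θ => by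
    have h := (hasSum_blkCount (q := Complex.exp (-(σ + θ * Complex.I)))
      (norm_exp_neg_lt_one (by simpa using hσ))).mul_right
        (Complex.exp (m * (σ + θ * Complex.I)))
    refine h.congr_fun fun k => ?_
    rw [← Complex.exp_nat_mul, mul_assoc, ← Complex.exp_add, ← Complex.exp_add]
    push_cast
    ring_nf
  have hr : ‖Real.exp (-σ)‖ < 1 := by
    rw [Real.norm_of_nonneg (Real.exp_pos _).le]; simpa using hσ
  have hb := (hasSum_blkCount hr).summable.mul_right (Real.exp (m * σ))
  have h := intervalIntegral.hasSum_integral_of_dominated_convergence (a := -π) (b := π)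
    (μ := volume) (fun (k : ℕ) (_ : ℝ) => (blkCount k : ℝ) * Real.exp (-σ) ^ k * Real.exp (m * σ))
    (fun k => (by fun_prop : Continuous fun θ : ℝ => (blkCount k : ℂ) *
      (Complex.exp (((m : ℝ) - k) * σ) *
        Complex.exp (((m - k : ℤ) : ℂ) * (θ * Complex.I)))).aestronglyMeasurable)
    (fun k => Eventually.of_forall fun θ _ => by
      rw [norm_mul, norm_mul, Complex.norm_exp, Complex.norm_exp, ← Real.exp_nat_mul, mul_assoc,
        ← Real.exp_add, ← Real.exp_add]
      simp
      ring_nf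
      rfl)
    (Eventually.of_forall fun θ _ => hb) (by simp) (Eventually.of_forall fun θ _ => key θ)
  refine h.unique ?_
  have e : ∀ k : ℕ, ∫ θ in -π..π, (blkCount k : ℂ) * (Complex.exp (((m : ℝ) - k) * σ) *
      Complex.exp (((m - k : ℤ) : ℂ) * (θ * Complex.I))) =
      if k = m then 2 * π * (blkCount m : ℂ) else 0 := fun k => by
    rw [intervalIntegral.integral_const_mul, intervalIntegral.integral_const_mul,
      integral_exp_int_mul]
    by_cases hk : k = m
    · subst hk; simp; ring
    · have : (m - k : ℤ) ≠ 0 := by omega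
      simp [hk, this]
  simp only [e]
  exact hasSum_ite_eq m _

/-- The rescaled integrand on the major arc. -/
noncomputable def blkRescaled (m : ℕ) (σ u : ℝ) : ℂ :=
  Set.indicator {u : ℝ | |√σ * u| ≤ 1}
    (fun u => blkIntegrand m σ (σ * √σ * u) / (σ ^ 2 * Real.exp (2 * (m * σ)) : ℝ)) u

theorem blkExponent_eq {m σ : ℝ} (hσ : 0 < σ) (hm : m * σ ^ 2 = π ^ 2 / 4) (u : ℝ) :
    (π ^ 2 / 4 / (σ + (σ * √σ * u : ℝ) * Complex.I) + m * (σ + (σ * √σ * u : ℝ) * Complex.I) -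
      2 * (m * σ) : ℂ) = -(π ^ 2 / 4) * u ^ 2 / (1 + (√σ * u : ℝ) * Complex.I) := by
  have h1 : (1 + (√σ * u : ℝ) * Complex.I : ℂ) ≠ 0 := fun h => by
    have := congrArg Complex.re h
    simp at this
  have h2 : (σ : ℂ) ≠ 0 := by exact_mod_cast hσ.ne'
  have h3 : ((√σ : ℝ) : ℂ) ^ 2 = σ := by
    rw [← Complex.ofReal_pow, Real.sq_sqrt hσ.le]
  have h4 : (m * σ ^ 2 : ℂ) = π ^ 2 / 4 := by exact_mod_cast hm
  have h5 : (σ + (σ * √σ * u : ℝ) * Complex.I : ℂ) = σ * (1 + (√σ * u : ℝ) * Complex.I) := by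
    push_cast; ring
  have h6 : (m : ℂ) = π ^ 2 / 4 / σ ^ 2 := by rw [← h4]; field_simp
  rw [h5, h6]
  field_simp
  push_cast
  ring_nf
  simp only [Complex.I_sq, h3]
  ring

theorem re_blkExponent_le {ε : ℝ} (hε : |ε| ≤ 1) {a : ℝ} (ha : 0 ≤ a) :
    (-(a : ℂ) / (1 + ε * Complex.I)).re ≤ -(a / 2) := by
  have h1 : ε ^ 2 ≤ 1 := (sq_le_one_iff_abs_le_one ε).2 hε
  have h2 : (-(a : ℂ) / (1 + ε * Complex.I)).re = -(a / (1 + ε ^ 2)) := by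
    rw [Complex.div_re]
    simp [Complex.normSq_apply]
    ring
  rw [h2, neg_le_neg_iff]
  gcongr
  linarith

theorem norm_blkRescaled_le : ∃ C : ℝ, ∀ (m : ℕ) (σ u : ℝ), 0 < σ → σ ≤ 1 / 4 →
    m * σ ^ 2 = π ^ 2 / 4 → ‖blkRescaled m σ u‖ ≤ C * Real.exp (-(π ^ 2 / 8) * u ^ 2) := by
  obtain ⟨C, hC, h⟩ := exists_norm_blkGen_le
  refine ⟨C, fun m σ u hσ hσ4 hm => ?_⟩
  by_cases hu : |√σ * u| ≤ 1
  · have hs : (σ + (σ * √σ * u : ℝ) * Complex.I : ℂ).re = σ := by simp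
    have hi : (σ + (σ * √σ * u : ℝ) * Complex.I : ℂ).im = σ * (√σ * u) := by simp [mul_assoc]
    have h1 := h (σ + (σ * √σ * u : ℝ) * Complex.I) (by rwa [hs]) (by rwa [hs])
      (by rw [hs, hi, abs_mul, abs_of_pos hσ]; exact mul_le_of_le_one_right hσ.le hu)
    rw [hs] at h1
    have h2 := congrArg Complex.re (blkExponent_eq hσ hm u)
    have h3 := re_blkExponent_le hu (a := π ^ 2 / 4 * u ^ 2) (by positivity)
    rw [Complex.sub_re, Complex.add_re] at h2
    rw [blkRescaled, Set.indicator_of_mem (by exact hu), blkIntegrand, norm_div, norm_mul,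
      Complex.norm_real, Real.norm_of_nonneg (by positivity), div_le_iff₀ (by positivity),
      Complex.norm_exp (_ * _)]
    have e : (2 * ((m : ℝ) * σ : ℂ)).re = 2 * (m * σ) := by
      rw [show (2 * ((m : ℝ) * σ : ℂ)) = ((2 * (m * σ) : ℝ) : ℂ) by push_cast; rfl,
        Complex.ofReal_re]
    rw [e] at h2
    push_cast at h1 h2 h3 ⊢
    rw [neg_mul] at h2
    refine (mul_le_mul_of_nonneg_right h1 (Real.exp_pos _).le).trans ?_
    rw [mul_assoc, ← Real.exp_add]
    have h4 : rexp ((π ^ 2 / 4 / (σ + σ * √σ * u * Complex.I) : ℂ).re +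
        (m * (σ + σ * √σ * u * Complex.I) : ℂ).re) ≤
        rexp (-(π ^ 2 / 8) * u ^ 2) * rexp (2 * (m * σ)) := by
      rw [← Real.exp_add, Real.exp_le_exp]
      linarith
    calc _ ≤ C * σ ^ 2 * (rexp (-(π ^ 2 / 8) * u ^ 2) * rexp (2 * (m * σ))) := by gcongr
      _ = _ := by ring
  · rw [blkRescaled, Set.indicator_of_notMem (by exact hu), norm_zero]
    positivity

/-- The saddle point attached to the area `m`. -/
noncomputable def blkScale (m : ℕ) : ℝ := π / (2 * √m)

theorem blkScale_pos {m : ℕ} (hm : 0 < m) : 0 < blkScale m := by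
  unfold blkScale; positivity

theorem mul_blkScale_sq {m : ℕ} (hm : 0 < m) : m * blkScale m ^ 2 = π ^ 2 / 4 := by
  have : (√m : ℝ) ^ 2 = m := Real.sq_sqrt (Nat.cast_nonneg m)
  have hm' : (m : ℝ) ≠ 0 := by positivity
  rw [blkScale, div_pow, mul_pow, this]
  field_simp
  norm_num

theorem tendsto_sqrt_nat : Tendsto (fun m : ℕ => √(m : ℝ)) atTop atTop :=
  Real.tendsto_sqrt_atTop.comp tendsto_natCast_atTop_atTop

theorem tendsto_blkScale : Tendsto blkScale atTop (𝓝 0) :=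
  tendsto_const_nhds.div_atTop (tendsto_sqrt_nat.const_mul_atTop two_pos)

theorem tendsto_blkScale_within : Tendsto blkScale atTop (𝓝[>] 0) :=
  tendsto_nhdsWithin_iff.2 ⟨tendsto_blkScale,
    (eventually_gt_atTop 0).mono fun _ hm => blkScale_pos hm⟩

theorem tendsto_one_sub_exp_div : Tendsto (fun s : ℂ => (1 - Complex.exp (-(2 * s))) / s)
    (𝓝[≠] 0) (𝓝 2) := by
  have h : HasDerivAt (fun s : ℂ => 1 - Complex.exp (-(2 * s))) 2 0 := by
    have h1 : HasDerivAt (fun s : ℂ => -(2 * s)) (-(2 * 1)) 0 :=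
      ((hasDerivAt_id (0 : ℂ)).const_mul 2).neg
    simpa using h1.cexp.const_sub 1
  have h2 := h.tendsto_slope_zero
  refine h2.congr fun s => ?_
  simp [div_eq_inv_mul]

theorem tendsto_eulerProd_exp {ι : Type*} {l : Filter ι} {s : ι → ℂ} {a : ℝ} (ha : 0 < a)
    (h0 : Tendsto (fun i => (s i).re) l (𝓝[>] 0)) (him : ∀ᶠ i in l, |(s i).im| ≤ (s i).re) :
    Tendsto (fun i => eulerProd (Complex.exp (-(a / s i)))) l (𝓝 1) := by
  refine tendsto_eulerProd_zero.comp (squeeze_zero_norm' (a := fun i =>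
    Real.exp (-(a / 2 * (s i).re⁻¹))) ?_ ?_)
  · filter_upwards [him, (tendsto_nhdsWithin_iff.1 h0).2] with i hi hp
    refine (norm_exp_neg_div_le hp hi ha.le).trans (le_of_eq ?_)
    congr 2
    have : (s i).re ≠ 0 := (Set.mem_Ioi.1 hp).ne'
    field_simp
  · exact Real.tendsto_exp_neg_atTop_nhds_zero.comp
      ((tendsto_inv_nhdsGT_zero.comp h0).const_mul_atTop (by positivity))

theorem tendsto_blkRescaled (u : ℝ) : Tendsto (fun m : ℕ => blkRescaled m (blkScale m) u) atTop
    (𝓝 ((√2 / π * Real.exp (-(π ^ 2 / 4) * u ^ 2) : ℝ) : ℂ)) := by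
  set s : ℕ → ℂ := fun m => blkScale m + (blkScale m * √(blkScale m) * u : ℝ) * Complex.I
  set ε : ℕ → ℝ := fun m => √(blkScale m) * u
  have hε : Tendsto ε atTop (𝓝 0) := by
    have := (Real.continuous_sqrt.tendsto 0).comp tendsto_blkScale
    simpa [ε] using this.mul_const u
  have hz : Tendsto (fun m => 1 + (ε m : ℂ) * Complex.I) atTop (𝓝 1) := by
    have := (Complex.continuous_ofReal.tendsto 0).comp hε
    simpa using (this.mul_const Complex.I).const_add 1
  have hre : ∀ m, (s m).re = blkScale m := fun m => by simp [s]
  have hse : ∀ m, s m = blkScale m * (1 + (ε m : ℂ) * Complex.I) := fun m => by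
    simp only [s, ε]; push_cast; ring
  have hs0 : Tendsto s atTop (𝓝 0) := by
    have := ((Complex.continuous_ofReal.tendsto 0).comp tendsto_blkScale).mul hz
    simp only [Complex.ofReal_zero, zero_mul] at this
    exact this.congr fun m => (hse m).symm
  have hε1 : ∀ᶠ m in atTop, |ε m| ≤ 1 := by
    have h := hε.abs
    rw [abs_zero] at h
    exact h.eventually_le_const one_pos
  have hpos : ∀ᶠ m in atTop, 0 < blkScale m :=
      (eventually_gt_atTop 0).mono fun _ hm => blkScale_pos hm
  have hs1 : Tendsto s atTop (𝓝[≠] 0) := tendsto_nhdsWithin_iff.2 ⟨hs0, hpos.mono fun m hm h => by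
    have := hre m
    rw [h] at this
    simp at this
    exact hm.ne this⟩
  have him : ∀ᶠ m in atTop, |(s m).im| ≤ (s m).re := by
    filter_upwards [hε1, hpos] with m h1 h2
    have : (s m).im = blkScale m * ε m := by simp [s, ε, mul_assoc]
    rw [this, hre, abs_mul, abs_of_pos h2]
    exact mul_le_of_le_one_right h2.le h1
  have hre' : Tendsto (fun m => (s m).re) atTop (𝓝[>] 0) :=
    tendsto_blkScale_within.congr fun m => (hre m).symm
  have t1 := tendsto_one_sub_exp_div.comp hs1
  have t2 : Tendsto (fun m => Complex.exp (-s m / 8)) atTop (𝓝 1) := by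
    have : Tendsto (fun m => -s m / 8) atTop (𝓝 0) := by simpa using hs0.neg.div_const 8
    have := (Complex.continuous_exp.tendsto _).comp this
    rwa [Complex.exp_zero] at this
  have t3 := tendsto_eulerProd_exp (a := 4 * π ^ 2) (by positivity) hre' him
  have t4 := tendsto_eulerProd_exp (a := 2 * π ^ 2) (by positivity) hre' him
  have t5 : Tendsto (fun m => Complex.exp (-(π ^ 2 / 4) * u ^ 2 / (1 + (ε m : ℂ) * Complex.I)))
      atTop (𝓝 (Complex.exp (-(π ^ 2 / 4) * u ^ 2))) := by
    have := (tendsto_const_nhds (x := (-(π ^ 2 / 4) * u ^ 2 : ℂ))).div hz one_ne_zero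
    rw [div_one] at this
    exact (Complex.continuous_exp.tendsto _).comp this
  have t := ((((t1.mul_const ((√2 : ℂ) / (2 * π))).mul (hz.pow 2)).mul t2).mul t5).div
    (t3.mul t4) (by norm_num)
  have e : (2 * ((√2 : ℂ) / (2 * π)) * 1 ^ 2 * 1 * Complex.exp (-(π ^ 2 / 4) * u ^ 2) / (1 * 1)) =
      ((√2 / π * Real.exp (-(π ^ 2 / 4) * u ^ 2) : ℝ) : ℂ) := by
    push_cast
    ring
  rw [e] at t
  refine t.congr' ?_
  filter_upwards [hε1, hpos, eventually_gt_atTop 0] with m h1 h2 h3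
  have h4 : (blkScale m : ℂ) ≠ 0 := by exact_mod_cast h2.ne'
  have h5 : s m ≠ 0 := fun h => by
    have := hre m
    rw [h] at this
    simp at this
    exact h2.ne this
  rw [blkRescaled, Set.indicator_of_mem (by exact h1), blkIntegrand]
  change _ = blkGen (Complex.exp (-s m)) * Complex.exp (m * s m) / _
  have hexp : Complex.exp (π ^ 2 / 4 / s m) * Complex.exp (m * s m) =
      Complex.exp (-(π ^ 2 / 4) * u ^ 2 / (1 + (ε m : ℂ) * Complex.I)) *
        Complex.exp (2 * (m * blkScale m)) := by
    rw [← Complex.exp_add, ← Complex.exp_add]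
    congr 1
    exact sub_eq_iff_eq_add.1 (blkExponent_eq h2 (mul_blkScale_sq h3) u)
  rw [blkGen_transform (by rw [hre]; exact h2)]
  have h6 : (1 + (ε m : ℂ) * Complex.I) = s m / blkScale m := by rw [hse]; field_simp
  have h7 := Complex.exp_ne_zero (2 * (m * blkScale m))
  have h8 : Complex.exp (-(π ^ 2 / 4) * u ^ 2 / (1 + (ε m : ℂ) * Complex.I)) =
      Complex.exp (π ^ 2 / 4 / s m) * Complex.exp (m * s m) /
        Complex.exp (2 * (m * blkScale m)) := by rw [hexp]; field_simp
  simp only [Function.comp, Pi.div_apply]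
  rw [h8, h6]
  push_cast
  field_simp

/-- The order of magnitude of the coefficient integral. -/
noncomputable def blkMain (m : ℕ) : ℝ :=
  blkScale m ^ 3 * √(blkScale m) * Real.exp (2 * (m * blkScale m))

theorem blkMain_pos {m : ℕ} (hm : 0 < m) : 0 < blkMain m := by
  have := blkScale_pos hm
  unfold blkMain; positivity

theorem eventually_blkScale : ∀ᶠ m : ℕ in atTop, 0 < m ∧ blkScale m ≤ 1 / 4 :=
  (eventually_gt_atTop 0).and (tendsto_blkScale.eventually_le_const (by norm_num))

theorem integral_blkRescaled {m : ℕ} {σ : ℝ} (hσ : 0 < σ) :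
    ∫ θ in -σ..σ, blkIntegrand m σ θ =
      (σ ^ 3 * √σ * Real.exp (2 * (m * σ)) : ℝ) * ∫ u, blkRescaled m σ u := by
  have h1 : 0 < √σ := Real.sqrt_pos.2 hσ
  have hset : {u : ℝ | |√σ * u| ≤ 1} = Set.Icc (-(1 / √σ)) (1 / √σ) := by
    ext u
    rw [Set.mem_ofPred_eq, abs_mul, abs_of_pos h1, Set.mem_Icc, ← abs_le, le_div_iff₀ h1, mul_comm]
  have h2 := intervalIntegral.smul_integral_comp_mul_left (a := -(1 / √σ)) (b := 1 / √σ)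
    (blkIntegrand m σ) (σ * √σ)
  have h3 : σ * √σ * (1 / √σ) = σ := by field_simp
  have h4 : ((σ ^ 2 * Real.exp (2 * (m * σ)) : ℝ) : ℂ) ≠ 0 :=
    Complex.ofReal_ne_zero.2 (by positivity)
  simp only [blkRescaled]
  rw [mul_neg, h3] at h2
  rw [← h2, integral_indicator (by rw [hset]; exact measurableSet_Icc), hset,
    integral_Icc_eq_integral_Ioc, ← intervalIntegral.integral_of_le
      (by linarith [one_div_pos.2 h1]), intervalIntegral.integral_div, Complex.real_smul,
    ← mul_div_assoc, eq_div_iff h4]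
  push_cast
  ring

theorem tendsto_integral_blkRescaled :
    Tendsto (fun m : ℕ => ∫ u, blkRescaled m (blkScale m) u) atTop
      (𝓝 ((√2 / π * √(π / (π ^ 2 / 4)) : ℝ) : ℂ)) := by
  obtain ⟨C, hC⟩ := norm_blkRescaled_le
  rw [← integral_gaussian, ← integral_const_mul, ← integral_complex_ofReal]
  refine tendsto_integral_filter_of_dominated_convergence
    (fun u => C * Real.exp (-(π ^ 2 / 8) * u ^ 2)) ?_ ?_ ?_ ?_
  · filter_upwards [eventually_gt_atTop 0] with m hm
    have hσ := blkScale_pos hm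
    have hset : MeasurableSet {u : ℝ | |√(blkScale m) * u| ≤ 1} :=
      (isClosed_le (by fun_prop) continuous_const).measurableSet
    have hcont : Continuous fun u => blkIntegrand m (blkScale m) (blkScale m * √(blkScale m) * u) :=
      (continuous_blkIntegrand m hσ).comp (by fun_prop)
    exact ((hcont.div_const _).measurable.indicator hset).aestronglyMeasurable
  · filter_upwards [eventually_blkScale] with m hm
    exact Eventually.of_forall fun u =>
      hC m _ u (blkScale_pos hm.1) hm.2 (mul_blkScale_sq hm.1)
  · exact (integrable_exp_neg_mul_sq (by positivity)).const_mul C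
  · exact Eventually.of_forall fun u => tendsto_blkRescaled u

theorem blkGen_exp_le : ∃ C : ℝ, 0 < C ∧ ∀ σ : ℝ, 0 < σ → σ ≤ 1 / 4 →
    blkGen (Real.exp (-σ)) ≤ C * σ ^ 2 * Real.exp (π ^ 2 / 4 / σ) := by
  obtain ⟨C, hC, h⟩ := exists_norm_blkGen_le
  refine ⟨C, hC, fun σ hσ hσ4 => ?_⟩
  have h1 := h σ (by simpa) (by rwa [Complex.ofReal_re]) (by simpa using hσ.le)
  have h2 : Real.exp (-σ) < 1 := by simpa
  have e : (π ^ 2 / 4 / σ : ℂ) = ((π ^ 2 / 4 / σ : ℝ) : ℂ) := by push_cast; rfl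
  rw [← Complex.ofReal_neg, ← Complex.ofReal_exp,
    blkGen_ofReal (by rwa [abs_of_pos (Real.exp_pos _)]), Complex.norm_real,
    Real.norm_of_nonneg (blkGen_pos (Real.exp_pos _).le h2).le, e, Complex.ofReal_re,
    Complex.ofReal_re] at h1
  exact h1

theorem norm_one_sub_exp_ge {σ θ : ℝ} (hσ : 0 < σ) (hσ4 : σ ≤ 1 / 4) (h1 : σ ≤ |θ|) (h2 : |θ| ≤ π) :
    1.09 * (1 - Real.exp (-σ)) ≤ ‖1 - Complex.exp (-(σ + θ * Complex.I))‖ := by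
  set r := Real.exp (-σ) with hr
  have hr1 : 1 - σ ≤ r := by linarith [Real.add_one_le_exp (-σ)]
  have hr2 : r < 1 := by simpa [hr]
  have hcos := Real.cos_le_one_sub_mul_cos_sq h2
  have hπ : π ^ 2 ≤ 10 := by nlinarith [Real.pi_lt_d2, Real.pi_gt_three]
  have hsq : ‖1 - Complex.exp (-(σ + θ * Complex.I))‖ ^ 2 =
      (1 - r) ^ 2 + 2 * r * (1 - Real.cos θ) := by
    rw [← Complex.normSq_eq_norm_sq, Complex.normSq_apply, Complex.sub_re, Complex.sub_im,
      Complex.exp_re, Complex.exp_im]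
    simp
    rw [← hr]
    nlinarith [Real.sin_sq_add_cos_sq θ]
  have hθ : σ ^ 2 ≤ θ ^ 2 := by rw [← sq_abs θ]; exact pow_le_pow_left₀ hσ.le h1 2
  have h3 : 0.2 * σ ^ 2 ≤ 1 - Real.cos θ := by
    have : 1 / 5 ≤ 2 / π ^ 2 := by rw [div_le_div_iff₀ (by norm_num) (by positivity)]; linarith
    nlinarith [mul_le_mul this hθ (by positivity) (by positivity)]
  refine (sq_le_sq₀ (by linarith) (norm_nonneg _)).1 ?_
  rw [hsq]
  have h4 : (1 - r) ^ 2 ≤ σ ^ 2 := pow_le_pow_left₀ (by linarith) (by linarith) 2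
  nlinarith [mul_le_mul (by linarith : (3/4 : ℝ) ≤ r) h3 (by positivity) (by linarith)]

theorem norm_blkGen_le_of_far {σ θ : ℝ} (hσ : 0 < σ) (hσ4 : σ ≤ 1 / 4) (h1 : σ ≤ |θ|)
    (h2 : |θ| ≤ π) : ‖blkGen (Complex.exp (-(σ + θ * Complex.I)))‖ ≤
      4 / σ * Real.exp (-(0.08 / σ)) * blkGen (Real.exp (-σ)) := by
  set r := Real.exp (-σ) with hr
  set q := Complex.exp (-(σ + θ * Complex.I)) with hq
  have hqn : ‖q‖ = r := by rw [hq, Complex.norm_exp, hr]; simp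
  have hr0 : 0 < r := Real.exp_pos _
  have hr1 : 1 - σ ≤ r := by linarith [Real.add_one_le_exp (-σ)]
  have hr2 : r < 1 := by simpa [hr]
  have hr3 : σ / 2 ≤ 1 - r := by
    have h3 : r * (1 + σ) ≤ 1 := by
      have := Real.add_one_le_exp σ
      have h4 : r * Real.exp σ = 1 := by rw [hr, ← Real.exp_add]; simp
      nlinarith
    nlinarith
  have hrr : r ^ 2 < 1 := pow_lt_one₀ hr0.le hr2 two_ne_zero
  have hE := eulerProd_pos hr0.le hr2
  have hE2 := eulerProd_pos (sq_nonneg r) hrr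
  have a1 := eulerProd_mul_exp_le (q := q) (by rwa [hqn])
  rw [hqn] at a1
  have a2 : eulerProd (r ^ 2) ≤ ‖eulerProd (q ^ 2)‖ :=
    eulerProd_le_norm (by rw [norm_pow, hqn]) hrr
  have a3 : ‖1 - q ^ 2‖ ≤ 2 := by
    refine (norm_sub_le _ _).trans ?_
    rw [norm_one, norm_pow, hqn]; linarith
  have a4 := norm_one_sub_exp_ge hσ hσ4 h1 h2
  rw [← hq, ← hr] at a4
  have a5 : 1 / ‖1 - q‖ + 0.08 / σ ≤ 1 / (1 - r) := by
    have b1 : 1 / ‖1 - q‖ ≤ 1 / (1.09 * (1 - r)) :=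
      one_div_le_one_div_of_le (by nlinarith) a4
    have b2 : 0.08 / σ ≤ 0.08 / (1 - r) :=
      div_le_div_of_nonneg_left (by norm_num) (by linarith) (by linarith)
    have b3 : 1 / (1.09 * (1 - r)) + 0.08 / (1 - r) ≤ 1 / (1 - r) := by
      have : 0 < 1 - r := by linarith
      rw [← sub_nonneg]
      have : 1 / (1 - r) - (1 / (1.09 * (1 - r)) + 0.08 / (1 - r)) =
        (1 - 1 / 1.09 - 0.08) / (1 - r) := by field_simp; norm_num
      rw [this]
      exact div_nonneg (by norm_num) (by linarith)
    linarith
  have a6 : eulerProd r * Real.exp (0.08 / σ) ≤ ‖eulerProd q‖ := by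
    refine le_of_mul_le_mul_right ?_ (Real.exp_pos (1 / ‖1 - q‖))
    refine le_trans ?_ a1
    rw [mul_assoc, ← Real.exp_add]
    gcongr
    linarith
  rw [blkGen, norm_div, norm_mul]
  calc _ ≤ 2 / (eulerProd r * Real.exp (0.08 / σ) * eulerProd (r ^ 2)) := by gcongr
    _ = 2 * Real.exp (-(0.08 / σ)) / (eulerProd r * eulerProd (r ^ 2)) := by
      rw [Real.exp_neg]; field_simp
    _ ≤ (4 / σ * (1 - r ^ 2)) * Real.exp (-(0.08 / σ)) / (eulerProd r * eulerProd (r ^ 2)) := by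
      gcongr
      rw [div_mul_eq_mul_div, le_div_iff₀ hσ]
      nlinarith
    _ = _ := by rw [blkGen]; ring

theorem exists_norm_blkIntegrand_le_of_far : ∃ C : ℝ, 0 < C ∧ ∀ (m : ℕ) (σ θ : ℝ), 0 < σ →
    σ ≤ 1 / 4 → m * σ ^ 2 = π ^ 2 / 4 → σ ≤ |θ| → |θ| ≤ π → ‖blkIntegrand m σ θ‖ ≤
      C * σ * Real.exp (-(0.08 / σ)) * Real.exp (2 * (m * σ)) := by
  obtain ⟨C, hC, h⟩ := blkGen_exp_le
  refine ⟨4 * C, by positivity, fun m σ θ hσ hσ4 hm h1 h2 => ?_⟩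
  have e1 : ‖Complex.exp (m * (σ + θ * Complex.I))‖ = Real.exp (m * σ) := by
    rw [Complex.norm_exp]; simp
  have e2 : π ^ 2 / 4 / σ = m * σ := by rw [← hm]; field_simp
  have h3 := h σ hσ hσ4
  rw [e2] at h3
  rw [blkIntegrand, norm_mul, e1]
  calc _ ≤ 4 / σ * Real.exp (-(0.08 / σ)) * (C * σ ^ 2 * Real.exp (m * σ)) * Real.exp (m * σ) := by
        gcongr
        exact (norm_blkGen_le_of_far hσ hσ4 h1 h2).trans (by gcongr)
    _ = _ := by
      rw [two_mul, Real.exp_add]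
      field_simp

theorem tendsto_far_error {c : ℝ} (hc : 0 < c) (k : ℕ) :
    Tendsto (fun m : ℕ => Real.exp (-(c / blkScale m)) / blkScale m ^ k) atTop (𝓝 0) := by
  have h := (Real.tendsto_pow_mul_exp_neg_atTop_nhds_zero k).comp
    ((tendsto_inv_nhdsGT_zero.comp tendsto_blkScale_within).const_mul_atTop hc)
  have h2 := h.const_mul ((c ^ k)⁻¹)
  rw [mul_zero] at h2
  refine h2.congr fun m => ?_
  simp only [Function.comp, ← div_eq_mul_inv, div_pow]
  field_simp

theorem tendsto_blkCount_div_blkMain :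
    Tendsto (fun m : ℕ => blkCount m / blkMain m) atTop
      (𝓝 (√2 / π * √(π / (π ^ 2 / 4)) / (2 * π))) := by
  obtain ⟨C, hC, hfar⟩ := exists_norm_blkIntegrand_le_of_far
  have hmain := tendsto_integral_blkRescaled
  have herr : Tendsto (fun m : ℕ => (2 * π * blkCount m / blkMain m : ℂ) -
      ∫ u, blkRescaled m (blkScale m) u) atTop (𝓝 0) := by
    have h := ((tendsto_far_error (c := 0.08) (by norm_num) 3).const_mul (2 * π * C))
    rw [mul_zero] at h
    refine squeeze_zero_norm' ?_ h
    filter_upwards [eventually_blkScale] with m hm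
    set σ := blkScale m with hσdef
    have hσ : 0 < σ := blkScale_pos hm.1
    have hN := blkMain_pos hm.1
    have hint : ∀ a b, IntervalIntegrable (blkIntegrand m σ) volume a b := fun a b =>
      (continuous_blkIntegrand m hσ).intervalIntegrable a b
    have hsplit := intervalIntegral.integral_add_adjacent_intervals (hint (-π) (-σ)) (hint (-σ) π)
    rw [← intervalIntegral.integral_add_adjacent_intervals (hint (-σ) σ) (hint σ π),
      integral_blkIntegrand m hσ, integral_blkRescaled hσ] at hsplit
    have hσπ : σ ≤ π := by linarith [hm.2, Real.pi_gt_three]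
    have hB : ∀ a b, a ≤ b → b - a ≤ π → (∀ θ ∈ Set.Ioc a b, σ ≤ |θ| ∧ |θ| ≤ π) →
        ‖∫ θ in a..b, blkIntegrand m σ θ‖ ≤
          C * σ * Real.exp (-(0.08 / σ)) * Real.exp (2 * (m * σ)) * π := fun a b hab hba hθ => by
      refine (intervalIntegral.norm_integral_le_of_norm_le_const
        (C := C * σ * Real.exp (-(0.08 / σ)) * Real.exp (2 * (m * σ))) fun θ h => ?_).trans
        (mul_le_mul_of_nonneg_left ?_ ?_)
      · rw [Set.uIoc_of_le hab] at h
        exact hfar m σ θ hσ hm.2 (mul_blkScale_sq hm.1) (hθ θ h).1 (hθ θ h).2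
      · rw [abs_of_nonneg (by linarith)]; exact hba
      · positivity
    have h1 := hB (-π) (-σ) (by linarith) (by linarith) fun θ h => by
      rw [abs_of_neg (by linarith [h.2])]
      constructor <;> linarith [h.1, h.2]
    have h2 := hB σ π hσπ (by linarith) fun θ h => by
      rw [abs_of_pos (by linarith [h.1])]
      constructor <;> linarith [h.1, h.2]
    have hNe : (σ ^ 3 * √σ * Real.exp (2 * (m * σ)) : ℝ) = blkMain m := rfl
    rw [hNe] at hsplit
    have hN' : (blkMain m : ℂ) ≠ 0 := Complex.ofReal_ne_zero.2 hN.ne'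
    have e : (2 * π * blkCount m / blkMain m : ℂ) - ∫ u, blkRescaled m σ u =
        ((∫ θ in -π..-σ, blkIntegrand m σ θ) + ∫ θ in σ..π, blkIntegrand m σ θ) / blkMain m := by
      rw [← hsplit]; field_simp; ring
    rw [e, norm_div, Complex.norm_real, Real.norm_of_nonneg hN.le, div_le_iff₀ hN]
    refine (norm_add_le _ _).trans ((add_le_add h1 h2).trans ?_)
    have hs1 : σ ≤ √σ := by
      rw [Real.le_sqrt' hσ]
      nlinarith [hm.2, hσ]
    calc _ = 2 * π * C * Real.exp (-(0.08 / σ)) * Real.exp (2 * (m * σ)) * σ := by ring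
      _ ≤ 2 * π * C * Real.exp (-(0.08 / σ)) * Real.exp (2 * (m * σ)) * √σ := by gcongr
      _ = _ := by rw [blkMain, ← hσdef]; field_simp
  have h := herr.add hmain
  rw [zero_add] at h
  have h2 := ((Complex.continuous_re.tendsto _).comp h).div_const (2 * π)
  rw [Complex.ofReal_re] at h2
  refine h2.congr fun m => ?_
  have e : (2 * π * blkCount m / blkMain m : ℂ) = ((2 * π * blkCount m / blkMain m : ℝ) : ℂ) := by
    push_cast; rfl
  simp only [Function.comp, sub_add_cancel, e, Complex.ofReal_re]
  field_simp

theorem tendsto_blkCount : Tendsto (fun m : ℕ => blkCount m /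
    ((m : ℝ) ^ (-(7 : ℝ) / 4) * Real.exp (π * √m))) atTop (𝓝 (π / 8)) := by
  have hc : √2 / π * √(π / (π ^ 2 / 4)) / (2 * π) * (π ^ 3 / 8 * √(π / 2)) = π / 8 := by
    have e1 : π / (π ^ 2 / 4) = 2 ^ 2 / π := by field_simp; norm_num
    rw [e1, Real.sqrt_div (by positivity), Real.sqrt_sq (by norm_num), Real.sqrt_div Real.pi_pos.le]
    field_simp
  rw [← hc]
  refine (tendsto_blkCount_div_blkMain.mul_const _).congr' ?_
  filter_upwards [eventually_gt_atTop 0] with m hm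
  have hm' : (0 : ℝ) < m := by exact_mod_cast hm
  have h1 : 2 * (m * blkScale m) = π * √m := by
    have : (√m : ℝ) * √m = m := Real.mul_self_sqrt hm'.le
    rw [blkScale]
    field_simp
    nlinarith
  have h2 : blkScale m ^ 3 * √(blkScale m) = (m : ℝ) ^ (-(7 : ℝ) / 4) * (π ^ 3 / 8 * √(π / 2)) := by
    have h3 : blkScale m = π / 2 * (m : ℝ) ^ (-(1 : ℝ) / 2) := by
      rw [blkScale, neg_div, Real.rpow_neg hm'.le, ← Real.sqrt_eq_rpow]
      field_simp
    rw [h3, Real.sqrt_mul (by positivity), Real.sqrt_eq_rpow ((m : ℝ) ^ _), ← Real.rpow_mul hm'.le,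
      mul_pow, ← Real.rpow_mul_natCast hm'.le]
    have h4 : (m : ℝ) ^ (-(7 : ℝ) / 4) =
        (m : ℝ) ^ (-(1 : ℝ) / 2 * (3 : ℕ)) * (m : ℝ) ^ (-(1 : ℝ) / 2 * (1 / 2)) := by
      rw [← Real.rpow_add hm']; norm_num
    rw [h4]; ring
  rw [blkMain, h1, h2]
  field_simp

/-- The multisets of blocks of total area `m`. -/
def blkSet (m : ℕ) : Set (Multiset (ℕ ⊕ ℕ)) := {M | (M.map blkArea).sum = m}

theorem ncard_blkSet (m : ℕ) : (blkSet m).ncard = blkCount m := (Nat.card_coe_set_eq _).symm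

theorem finite_blkSet (m : ℕ) : (blkSet m).Finite := Set.finite_coe_iff.1 (finite_blk m)

/-- The length of a block of width one, if it is at most `K`. -/
def smallLength (K : ℕ) : ℕ ⊕ ℕ → ℕ := Sum.elim (fun k => if k < K then k + 1 else 0) fun _ => 0

/-- The total length of the blocks of width one and length at most `K`. -/
def smallSum (K : ℕ) (M : Multiset (ℕ ⊕ ℕ)) : ℕ := (M.map (smallLength K)).sum

theorem smallSum_mono {K L : ℕ} (h : K ≤ L) (M : Multiset (ℕ ⊕ ℕ)) :
    smallSum K M ≤ smallSum L M := by
  refine Multiset.sum_map_le_sum_map _ _ fun b _ => ?_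
  rcases b with k | j
  · simp only [smallLength, Sum.elim_inl]
    split_ifs <;> omega
  · simp [smallLength]

theorem ncard_smallSum_le (m S K : ℕ) {x y : ℝ} (hx : 0 < x) (hx1 : x < 1) (hy : 0 < y)
    (hy1 : y ≤ 1) : ({M ∈ blkSet m | smallSum K M ≤ S}.ncard : ℝ) * (x ^ m * y ^ S) ≤
      blkGen x * ∏ k ∈ Finset.range K, (1 - x ^ (k + 1)) / (1 - (x * y) ^ (k + 1)) := by
  set w : ℕ ⊕ ℕ → ℝ := fun b => x ^ blkArea b * y ^ smallLength K b with hw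
  have hxn : ‖x‖ < 1 := by rwa [Real.norm_of_nonneg hx.le]
  have hw0 : ∀ b, 0 ≤ w b := fun b => by positivity
  have hwle : ∀ b, w b ≤ x ^ blkArea b := fun b =>
    mul_le_of_le_one_right (by positivity) (pow_le_one₀ hy.le hy1)
  have hnorm : ∀ b, ‖w b‖ ≤ ‖x ^ blkArea b‖ := fun b => by
    rw [Real.norm_of_nonneg (hw0 b), Real.norm_of_nonneg (by positivity)]
    exact hwle b
  obtain ⟨h1, h2⟩ := hasProd_multiset w
    (fun b => (hnorm b).trans_lt (norm_pow_blkArea_lt_one hxn b))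
    (Summable.of_nonneg_of_le (fun b => norm_nonneg _) hnorm (summable_norm_pow_blkArea hxn))
  have h3 : HasProd (fun b => (1 - x ^ blkArea b) / (1 - w b))
      (∏ b ∈ (Finset.range K).map Function.Embedding.inl,
        (1 - x ^ blkArea b) / (1 - w b)) := by
    refine hasProd_prod_of_ne_finset_one fun b hb => ?_
    have : w b = x ^ blkArea b := by
      rcases b with k | j
      · have hk : ¬ k < K := by simpa using hb
        simp [w, smallLength, hk]
      · simp [w, smallLength]
    have h4 : 1 - x ^ blkArea b ≠ 0 := by
      have := norm_pow_blkArea_lt_one hxn b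
      rw [Real.norm_of_nonneg (by positivity)] at this
      linarith
    rw [this, div_self h4]
  have h4 := (hasProd_blkGen hxn).mul h3
  have h5 : ∀ b, (1 - x ^ blkArea b)⁻¹ * ((1 - x ^ blkArea b) / (1 - w b)) =
      (1 - w b)⁻¹ := fun b => by
    have : 1 - x ^ blkArea b ≠ 0 := by
      have := norm_pow_blkArea_lt_one hxn b
      rw [Real.norm_of_nonneg (by positivity)] at this
      linarith
    field_simp
  simp only [h5] at h4
  have h6 := h4.unique h2
  rw [Finset.prod_map] at h6
  have h7 : ∏ k ∈ Finset.range K, (1 - x ^ (k + 1)) / (1 - (x * y) ^ (k + 1)) =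
      ∏ k ∈ Finset.range K, (1 - x ^ blkArea (Function.Embedding.inl k)) /
        (1 - w (Function.Embedding.inl k)) := by
    refine Finset.prod_congr rfl fun k hk => ?_
    simp [w, blkArea, smallLength, Finset.mem_range.1 hk, mul_pow]
  rw [h7, h6]
  have hfin : {M ∈ blkSet m | smallSum K M ≤ S}.Finite := (finite_blkSet m).subset fun M h => h.1
  rw [Set.ncard_eq_toFinset_card _ hfin, ← nsmul_eq_mul]
  refine (Finset.card_nsmul_le_sum _ (fun M => (M.map w).prod) _ fun M hM => ?_).trans
    (h1.of_norm.sum_le_tsum _ fun M _ => Multiset.prod_nonneg fun a ha => ?_)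
  · rw [Set.Finite.mem_toFinset] at hM
    rw [hw, Multiset.prod_map_mul, prod_map_pow, prod_map_pow,
      show (M.map blkArea).sum = m from hM.1]
    exact mul_le_mul_of_nonneg_left (pow_le_pow_of_le_one hy.le hy1 hM.2) (by positivity)
  · obtain ⟨b, -, rfl⟩ := Multiset.mem_map.1 ha
    exact hw0 b

theorem ncard_mem (j : ℕ) (b : ℕ ⊕ ℕ) :
    {M ∈ blkSet (j + blkArea b) | b ∈ M}.ncard = blkCount j := by
  rw [← ncard_blkSet]
  have h : {M ∈ blkSet (j + blkArea b) | b ∈ M} = (b ::ₘ ·) '' blkSet j := by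
    ext M
    constructor
    · rintro ⟨h1, h2⟩
      obtain ⟨N, rfl⟩ := Multiset.exists_cons_of_mem h2
      refine ⟨N, ?_, rfl⟩
      simp only [blkSet, Set.mem_ofPred_eq, Multiset.map_cons, Multiset.sum_cons] at h1 ⊢
      omega
    · rintro ⟨N, h1, rfl⟩
      refine ⟨?_, Multiset.mem_cons_self _ _⟩
      simp only [blkSet, Set.mem_ofPred_eq, Multiset.map_cons, Multiset.sum_cons] at h1 ⊢
      omega
  rw [h, Set.ncard_image_of_injective _ fun _ _ => (Multiset.cons_inj_right b).1]

theorem ncard_notMem (j : ℕ) (b : ℕ ⊕ ℕ) :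
    {M ∈ blkSet (j + blkArea b) | b ∉ M}.ncard + blkCount j = blkCount (j + blkArea b) := by
  rw [← ncard_mem j b, ← ncard_blkSet, ← Set.ncard_union_eq ?_ ?_ ?_]
  · congr 1
    ext M
    simp only [Set.mem_union, Set.mem_ofPred_eq]
    tauto
  · exact Set.disjoint_left.2 fun M h1 h2 => h1.2 h2.2
  · exact (finite_blkSet _).subset fun M h => h.1
  · exact (finite_blkSet _).subset fun M h => h.1

theorem blkCount_mul_pow_le (m : ℕ) {x : ℝ} (hx : 0 ≤ x) (hx1 : x < 1) :
    blkCount m * x ^ m ≤ blkGen x :=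
  le_hasSum (hasSum_blkCount (by rwa [Real.norm_of_nonneg hx])) m fun _ _ => by positivity

theorem ncard_large_le (m S : ℕ) {x : ℝ} (hx : 0 < x) (hx1 : x < 1) :
    ({M ∈ blkSet m | ∃ k > S, Sum.inl k ∈ M}.ncard : ℝ) * x ^ m ≤ m * x ^ S * blkGen x := by
  have hG := blkGen_pos hx.le hx1
  have hsub : {M ∈ blkSet m | ∃ k > S, Sum.inl k ∈ M} ⊆
      ⋃ k ∈ Finset.Ico (S + 1) m, {M ∈ blkSet m | Sum.inl k ∈ M} := by
    rintro M ⟨hM, k, hk, hkM⟩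
    have : blkArea (Sum.inl k) ≤ m := by
      rw [← show (M.map blkArea).sum = m from hM]
      exact Multiset.single_le_sum (fun _ _ => Nat.zero_le _) _ (Multiset.mem_map_of_mem _ hkM)
    simp only [blkArea, Sum.elim_inl] at this
    simp only [Set.mem_iUnion, Finset.mem_Ico]
    exact ⟨k, by omega, hM, hkM⟩
  have h1 : ({M ∈ blkSet m | ∃ k > S, Sum.inl k ∈ M}.ncard : ℝ) ≤
      ∑ k ∈ Finset.Ico (S + 1) m, ({M ∈ blkSet m | Sum.inl k ∈ M}.ncard : ℝ) := by
    rw [← Nat.cast_sum, Nat.cast_le]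
    refine (Set.ncard_le_ncard hsub ?_).trans (Finset.set_ncard_biUnion_le _ _)
    exact (finite_blkSet m).subset (Set.iUnion₂_subset fun k _ M h => h.1)
  have h2 : ∀ k ∈ Finset.Ico (S + 1) m,
      ({M ∈ blkSet m | Sum.inl k ∈ M}.ncard : ℝ) * x ^ m ≤ x ^ S * blkGen x := by
    intro k hk
    rw [Finset.mem_Ico] at hk
    obtain ⟨j, rfl⟩ : ∃ j, m = j + (k + 1) := ⟨m - (k + 1), by omega⟩
    have h3 := ncard_mem j (Sum.inl k)
    simp only [blkArea, Sum.elim_inl] at h3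
    rw [h3, pow_add, ← mul_assoc, mul_comm (x ^ S)]
    exact mul_le_mul (blkCount_mul_pow_le j hx.le hx1)
      (pow_le_pow_of_le_one hx.le hx1.le (by omega))
      (by positivity) hG.le
  calc _ ≤ (∑ k ∈ Finset.Ico (S + 1) m, ({M ∈ blkSet m | Sum.inl k ∈ M}.ncard : ℝ)) * x ^ m := by
        gcongr
    _ ≤ ∑ k ∈ Finset.Ico (S + 1) m, x ^ S * blkGen x := by
        rw [Finset.sum_mul]; exact Finset.sum_le_sum h2
    _ ≤ _ := by
        rw [Finset.sum_const, Nat.card_Ico, nsmul_eq_mul, mul_assoc]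
        gcongr
        omega

/-- The multisets of blocks in which some block of width one is longer than one plus the total
length of all shorter blocks of width one. -/
def blkBad (m : ℕ) : Set (Multiset (ℕ ⊕ ℕ)) :=
  {M ∈ blkSet m | ∃ k, Sum.inl k ∈ M ∧ smallSum k M < k}

theorem blkBad_subset (m R S : ℕ) : blkBad m ⊆
    (⋃ s ∈ Finset.range 3, {M ∈ blkSet m | Sum.inl s ∉ M}) ∪ {M ∈ blkSet m | smallSum 3 M ≤ R} ∪
      {M ∈ blkSet m | smallSum R M ≤ S} ∪ {M ∈ blkSet m | ∃ k > S, Sum.inl k ∈ M} := by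
  rintro M ⟨hM, k, hk, hlt⟩
  set s := smallSum k M with hs
  have hsk : smallSum s M ≤ s := smallSum_mono hlt.le M
  have hsM : Sum.inl s ∉ M := fun h => by
    have h1 : smallLength k (Sum.inl s) ≤ smallSum k M :=
      Multiset.single_le_sum (fun _ _ => Nat.zero_le _) _ (Multiset.mem_map_of_mem _ h)
    simp only [smallLength, Sum.elim_inl, if_pos hlt] at h1
    omega
  rcases lt_or_ge s 3 with h3 | h3
  · refine Or.inl (Or.inl (Or.inl ?_))
    simp only [Set.mem_iUnion]
    exact ⟨s, Finset.mem_range.2 h3, hM, hsM⟩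
  rcases le_or_gt s R with hR | hR
  · exact Or.inl (Or.inl (Or.inr ⟨hM, (smallSum_mono h3 M).trans (hsk.trans hR)⟩))
  rcases le_or_gt s S with hS | hS
  · exact Or.inl (Or.inr ⟨hM, (smallSum_mono hR.le M).trans (hsk.trans hS)⟩)
  · exact Or.inr ⟨hM, k, hS.trans hlt, hk⟩

theorem ncard_blkBad_le (m R S : ℕ) : ((blkBad m).ncard : ℝ) ≤
    ∑ s ∈ Finset.range 3, ({M ∈ blkSet m | Sum.inl s ∉ M}.ncard : ℝ) +
      {M ∈ blkSet m | smallSum 3 M ≤ R}.ncard + {M ∈ blkSet m | smallSum R M ≤ S}.ncard +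
      {M ∈ blkSet m | ∃ k > S, Sum.inl k ∈ M}.ncard := by
  have hfin : ∀ p : Multiset (ℕ ⊕ ℕ) → Prop, {M ∈ blkSet m | p M} ⊆ blkSet m := fun p M h => h.1
  have h1 := Set.ncard_le_ncard (blkBad_subset m R S) ((finite_blkSet m).subset (by
    refine Set.union_subset (Set.union_subset (Set.union_subset
      (Set.iUnion₂_subset fun s _ => hfin _) (hfin _)) (hfin _)) (hfin _)))
  have h2 := Finset.set_ncard_biUnion_le (Finset.range 3)
    fun s => {M ∈ blkSet m | Sum.inl s ∉ M}
  rw [← Nat.cast_sum]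
  norm_cast
  refine h1.trans ((Set.ncard_union_le _ _).trans ?_)
  gcongr
  refine (Set.ncard_union_le _ _).trans ?_
  gcongr
  refine (Set.ncard_union_le _ _).trans ?_
  gcongr

theorem one_sub_exp_neg_le (σ : ℝ) : 1 - Real.exp (-σ) ≤ σ := by
  linarith [Real.add_one_le_exp (-σ)]

theorem ncard_smallSum_three_le (m : ℕ) {R : ℕ} (hR : 0 < R) {σ : ℝ} (hσ : 0 < σ) :
    ({M ∈ blkSet m | smallSum 3 M ≤ R}.ncard : ℝ) ≤
      432 * (σ * R) ^ 3 * (blkGen (Real.exp (-σ)) * Real.exp (m * σ)) := by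
  set x := Real.exp (-σ) with hxdef
  have hx : 0 < x := Real.exp_pos _
  have hx1 : x < 1 := by simpa [hxdef]
  have hR' : (1 : ℝ) ≤ R := by exact_mod_cast hR
  set y : ℝ := 1 - 1 / (2 * R) with hydef
  have hR2 : 1 / (2 * (R : ℝ)) ≤ 1 / 2 := by
    apply one_div_le_one_div_of_le <;> linarith
  have hR3 : 0 < 1 / (2 * (R : ℝ)) := by positivity
  have hy : 0 < y := by linarith
  have hy1 : y ≤ 1 := by linarith
  have hG := blkGen_pos hx.le hx1
  have h := ncard_smallSum_le m R 3 hx hx1 hy hy1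
  have h1 : 1 / 2 ≤ y ^ R := by
    have h2 := one_add_mul_le_pow (a := -(1 / (2 * (R : ℝ)))) (by linarith) R
    have h3 : 1 + R * -(1 / (2 * (R : ℝ))) = 1 / 2 := by field_simp; norm_num
    rw [h3] at h2
    rwa [hydef, sub_eq_add_neg]
  have h2 : ∏ k ∈ Finset.range 3, (1 - x ^ (k + 1)) / (1 - (x * y) ^ (k + 1)) ≤
      ∏ _k ∈ Finset.range 3, 6 * (σ * R) := by
    have hxy : 0 < x * y := by positivity
    have hxy1 : x * y ≤ y := mul_le_of_le_one_left hy.le hx1.le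
    refine Finset.prod_le_prod (fun k _ => ?_) fun k hk => ?_
    · exact div_nonneg (sub_nonneg.2 (pow_le_one₀ hx.le hx1.le))
        (sub_nonneg.2 (pow_le_one₀ hxy.le (by linarith)))
    · have hk : (k : ℝ) + 1 ≤ 3 := by
        have := Finset.mem_range.1 hk
        exact_mod_cast this
      have a1 : 1 - x ^ (k + 1) ≤ 3 * σ := by
        have h3 := one_add_mul_le_pow (a := x - 1) (by linarith) (k + 1)
        have h4 := one_sub_exp_neg_le σ
        rw [add_sub_cancel] at h3
        push_cast at h3
        nlinarith
      have a2 : 1 / (2 * (R : ℝ)) ≤ 1 - (x * y) ^ (k + 1) := by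
        have := pow_le_of_le_one hxy.le (hxy1.trans hy1) (Nat.add_one_ne_zero k)
        linarith
      calc _ ≤ 3 * σ / (1 / (2 * (R : ℝ))) := by gcongr
        _ = _ := by field_simp; norm_num
  rw [Finset.prod_const, Finset.card_range] at h2
  have h3 : x ^ m * Real.exp (m * σ) = 1 := by
    rw [hxdef, ← Real.exp_nat_mul, ← Real.exp_add]; simp
  set N := ({M ∈ blkSet m | smallSum 3 M ≤ R}.ncard : ℝ)
  have hN : 0 ≤ N := Nat.cast_nonneg _
  calc N = N * (x ^ m * (1 / 2)) * (2 * Real.exp (m * σ)) := by linear_combination (-N) * h3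
    _ ≤ N * (x ^ m * y ^ R) * (2 * Real.exp (m * σ)) := by gcongr
    _ ≤ blkGen x * (6 * (σ * R)) ^ 3 * (2 * Real.exp (m * σ)) := by
      exact mul_le_mul_of_nonneg_right (h.trans (by gcongr)) (by positivity)
    _ = _ := by ring

theorem ncard_smallSum_middle_le (m R S : ℕ) {σ : ℝ} (hσ : 0 < σ) (hR : σ * R ≤ 1 / 2) :
    ({M ∈ blkSet m | smallSum R M ≤ S}.ncard : ℝ) ≤
      (2 / 3) ^ R * Real.exp (S * σ) * (blkGen (Real.exp (-σ)) * Real.exp (m * σ)) := by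
  set x := Real.exp (-σ) with hxdef
  have hx : 0 < x := Real.exp_pos _
  have hx1 : x < 1 := by simpa [hxdef]
  have hG := blkGen_pos hx.le hx1
  have h := ncard_smallSum_le m S R hx hx1 hx hx1.le
  have h2 : ∏ k ∈ Finset.range R, (1 - x ^ (k + 1)) / (1 - (x * x) ^ (k + 1)) ≤
      ∏ _k ∈ Finset.range R, (2 / 3 : ℝ) := by
    refine Finset.prod_le_prod (fun k _ => ?_) fun k hk => ?_
    · exact div_nonneg (sub_nonneg.2 (pow_le_one₀ hx.le hx1.le))
        (sub_nonneg.2 (pow_le_one₀ (by positivity) (by nlinarith)))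
    · have a1 : 1 / 2 ≤ x ^ (k + 1) := by
        have h3 := pow_le_pow_of_le_one hx.le hx1.le (Nat.succ_le_of_lt (Finset.mem_range.1 hk))
        have h4 := Real.add_one_le_exp (R * -σ)
        rw [Real.exp_nat_mul, ← hxdef] at h4
        refine le_trans ?_ h3
        linarith
      have a2 : x ^ (k + 1) < 1 := pow_lt_one₀ hx.le hx1 k.succ_ne_zero
      have a3 : (x * x) ^ (k + 1) = x ^ (k + 1) * x ^ (k + 1) := mul_pow _ _ _
      rw [a3, div_le_div_iff₀ (by nlinarith) (by norm_num)]
      nlinarith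
  rw [Finset.prod_const, Finset.card_range] at h2
  have h3 : ∀ n : ℕ, x ^ n * Real.exp (n * σ) = 1 := fun n => by
    rw [hxdef, ← Real.exp_nat_mul, ← Real.exp_add]; simp
  set N := ({M ∈ blkSet m | smallSum R M ≤ S}.ncard : ℝ)
  calc N = N * (x ^ m * x ^ S) * (Real.exp (m * σ) * Real.exp (S * σ)) := by
        linear_combination (-N) * h3 m - N * x ^ m * Real.exp (m * σ) * h3 S
    _ ≤ blkGen x * (2 / 3) ^ R * (Real.exp (m * σ) * Real.exp (S * σ)) := by
      exact mul_le_mul_of_nonneg_right (h.trans (by gcongr)) (by positivity)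
    _ = _ := by ring

theorem ncard_large_le_exp (m S : ℕ) {σ : ℝ} (hσ : 0 < σ) :
    ({M ∈ blkSet m | ∃ k > S, Sum.inl k ∈ M}.ncard : ℝ) ≤
      m * Real.exp (-(S * σ)) * (blkGen (Real.exp (-σ)) * Real.exp (m * σ)) := by
  have h := ncard_large_le m S (Real.exp_pos (-σ)) (by simpa)
  have h3 : ∀ n : ℕ, Real.exp (-σ) ^ n = Real.exp (-(n * σ)) := fun n => by
    rw [← Real.exp_nat_mul, mul_neg]
  rw [h3, h3, Real.exp_neg (m * σ), ← div_eq_mul_inv, div_le_iff₀ (Real.exp_pos _)] at h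
  exact h.trans (le_of_eq (by ring))

theorem tendsto_blkCount_add_div (k : ℕ) :
    Tendsto (fun j : ℕ => (blkCount j : ℝ) / blkCount (j + k)) atTop (𝓝 1) := by
  have hne : (π / 8) ≠ 0 := by positivity
  have h1 := tendsto_blkCount.div (tendsto_blkCount.comp (tendsto_add_atTop_nat k)) hne
  rw [div_self hne] at h1
  have h2 : Tendsto (fun j : ℕ => ((j : ℝ) / ((j + k : ℕ) : ℝ)) ^ (-(7 : ℝ) / 4)) atTop (𝓝 1) := by
    have : Tendsto (fun j : ℕ => (j : ℝ) / ((j + k : ℕ) : ℝ)) atTop (𝓝 1) := by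
      push_cast; exact tendsto_natCast_div_add_atTop (k : ℝ)
    simpa using this.rpow_const (p := -(7 : ℝ) / 4) (Or.inl one_ne_zero)
  have h3 : Tendsto (fun j : ℕ => Real.exp (π * (√(j : ℝ) - √((j + k : ℕ) : ℝ)))) atTop (𝓝 1) := by
    have h4 : Tendsto (fun j : ℕ => π * (√(j : ℝ) - √((j + k : ℕ) : ℝ))) atTop (𝓝 0) := by
      have h5 : Tendsto (fun j : ℕ => π * k / √(j : ℝ)) atTop (𝓝 0) :=
        tendsto_const_nhds.div_atTop tendsto_sqrt_nat
      refine squeeze_zero_norm' ?_ h5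
      filter_upwards [eventually_gt_atTop 0] with j hj
      have hj' : 0 < √(j : ℝ) := Real.sqrt_pos.2 (by exact_mod_cast hj)
      have h6 : √(j : ℝ) ≤ √((j + k : ℕ) : ℝ) := Real.sqrt_le_sqrt (by push_cast; simp)
      have h7 : √(j : ℝ) * √(j : ℝ) = j := Real.mul_self_sqrt (Nat.cast_nonneg j)
      have h8 : √((j + k : ℕ) : ℝ) * √((j + k : ℕ) : ℝ) = j + k := by
        rw [Real.mul_self_sqrt (Nat.cast_nonneg _)]; push_cast; rfl
      rw [norm_mul, Real.norm_of_nonneg Real.pi_pos.le, Real.norm_eq_abs,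
        abs_of_nonpos (by linarith),
        mul_div_assoc]
      refine mul_le_mul_of_nonneg_left ?_ Real.pi_pos.le
      rw [le_div_iff₀ hj']
      nlinarith
    have h5 := (Real.continuous_exp.tendsto _).comp h4
    rwa [Real.exp_zero] at h5
  have h := (h1.mul h2).mul h3
  simp only [mul_one] at h
  refine h.congr' ?_
  filter_upwards [eventually_gt_atTop 0] with j hj
  have hj' : (0 : ℝ) < j := by exact_mod_cast hj
  have hjk : (0 : ℝ) < (j + k : ℕ) := by exact_mod_cast Nat.add_pos_left hj k
  simp only [Function.comp, Pi.div_apply]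
  rw [Real.div_rpow hj'.le hjk.le, mul_sub, Real.exp_sub]
  have := Real.rpow_pos_of_pos hj' (-(7 : ℝ) / 4)
  have := Real.rpow_pos_of_pos hjk (-(7 : ℝ) / 4)
  field_simp

theorem blkGen_mul_exp_le : ∃ C : ℝ, 0 < C ∧ ∀ m : ℕ, 0 < m → blkScale m ≤ 1 / 4 →
    blkGen (Real.exp (-blkScale m)) * Real.exp (m * blkScale m) ≤
      C * (blkScale m ^ 2)⁻¹ * blkMain m := by
  obtain ⟨C, hC, h⟩ := blkGen_exp_le
  refine ⟨C, hC, fun m hm hσ4 => ?_⟩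
  have hσ := blkScale_pos hm
  have h1 := h _ hσ hσ4
  have e : π ^ 2 / 4 / blkScale m = m * blkScale m := by rw [← mul_blkScale_sq hm]; field_simp
  rw [e] at h1
  have hs1 : blkScale m ≤ √(blkScale m) := by
    rw [Real.le_sqrt' hσ]
    nlinarith
  calc _ ≤ C * blkScale m ^ 2 * Real.exp (m * blkScale m) * Real.exp (m * blkScale m) := by gcongr
    _ = C * (blkScale m ^ 2)⁻¹ *
        (blkScale m ^ 3 * blkScale m * Real.exp (2 * (m * blkScale m))) := by
      rw [two_mul, Real.exp_add]; field_simp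
    _ ≤ _ := by unfold blkMain; gcongr

theorem exists_cutoffs {t σ m : ℝ} (ht : 6 ≤ t) (hσ : t ^ 8 = σ⁻¹) (hm : m * σ ^ 2 = π ^ 2 / 4) :
    ∃ R S : ℕ, 0 < R ∧ σ * R ≤ 1 / 2 ∧
      (432 * (σ * R) ^ 3 + (2 / 3) ^ R * Real.exp (S * σ) + m * Real.exp (-(S * σ))) * (σ ^ 2)⁻¹ ≤
        432 / t ^ 2 + 2 * (t ^ 16 * Real.exp (-t)) + 9 * (t ^ 32 * Real.exp (-t)) := by
  have ht0 : 0 < t := by linarith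
  have hσ' : σ = (t ^ 8)⁻¹ := by rw [hσ, inv_inv]
  have hσ2 : (σ ^ 2)⁻¹ = t ^ 16 := by rw [hσ', inv_pow, inv_inv]; ring
  have hm' : m ≤ 3 * t ^ 16 := by
    have e : m = π ^ 2 / 4 * t ^ 16 := by rw [← hm, hσ']; field_simp
    rw [e]
    gcongr
    nlinarith [Real.pi_lt_d2, Real.pi_gt_three]
  have hR1 := Nat.floor_le (sq_nonneg t)
  have hR2 := Nat.lt_floor_add_one (t ^ 2)
  have hS1 := Nat.floor_le (pow_nonneg ht0.le 9)
  have hS2 := Nat.lt_floor_add_one (t ^ 9)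
  have hσ1 : σ ≤ 1 := by rw [hσ']; exact inv_le_one_of_one_le₀ (one_le_pow₀ (by linarith))
  have hσ0 : 0 < σ := by rw [hσ']; positivity
  have hσR : σ * ⌊t ^ 2⌋₊ ≤ (t ^ 6)⁻¹ := by
    calc _ ≤ (t ^ 8)⁻¹ * t ^ 2 := by rw [hσ']; gcongr
      _ = _ := by field_simp
  have e9 : t ^ 9 * σ = t := by rw [hσ']; field_simp
  have hSσ : ⌊t ^ 9⌋₊ * σ ≤ t := by
    calc _ ≤ t ^ 9 * σ := by gcongr
      _ = t := e9
  have hSσ' : t - 1 ≤ ⌊t ^ 9⌋₊ * σ := by nlinarith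
  refine ⟨⌊t ^ 2⌋₊, ⌊t ^ 9⌋₊, Nat.floor_pos.2 (by nlinarith), hσR.trans ?_, ?_⟩
  · rw [one_div]
    refine inv_anti₀ two_pos ?_
    have := pow_le_pow_left₀ (by norm_num) ht 6
    norm_num at this; linarith
  · have a1 : 432 * (σ * ⌊t ^ 2⌋₊) ^ 3 * t ^ 16 ≤ 432 / t ^ 2 := by
      calc _ ≤ 432 * ((t ^ 6)⁻¹) ^ 3 * t ^ 16 := by gcongr
        _ = _ := by field_simp
    have hexp1 : Real.exp (1 / 3) ≤ 2 := by
      have h1 := Real.exp_one_lt_d9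
      have h2 : Real.exp (1 / 3) ^ 3 = Real.exp 1 := by rw [← Real.exp_nat_mul]; norm_num
      have h3 := Real.exp_pos (1 / 3)
      by_contra! h
      have := pow_lt_pow_left₀ h (by norm_num) three_ne_zero
      linarith
    have a2 : (2 / 3 : ℝ) ^ ⌊t ^ 2⌋₊ * Real.exp (⌊t ^ 9⌋₊ * σ) ≤ 2 * Real.exp (-t) := by
      have h1 : (2 / 3 : ℝ) ≤ Real.exp (-(1 / 3)) := by
        linarith [Real.add_one_le_exp (-(1 / 3 : ℝ))]
      calc _ ≤ Real.exp (-(1 / 3)) ^ ⌊t ^ 2⌋₊ * Real.exp t := by gcongr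
        _ = Real.exp (⌊t ^ 2⌋₊ * -(1 / 3) + t) := by rw [← Real.exp_nat_mul, Real.exp_add]
        _ ≤ Real.exp (1 / 3 + -t) := Real.exp_le_exp.2 (by nlinarith)
        _ ≤ _ := by rw [Real.exp_add]; gcongr
    have a3 : m * Real.exp (-(⌊t ^ 9⌋₊ * σ)) ≤ 9 * t ^ 16 * Real.exp (-t) := by
      calc _ ≤ 3 * t ^ 16 * Real.exp (1 + -t) := by gcongr; linarith
        _ ≤ 3 * t ^ 16 * (3 * Real.exp (-t)) := by
          rw [Real.exp_add]
          have := Real.exp_one_lt_d9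
          gcongr
          linarith
        _ = _ := by ring
    have ht16 : 0 < t ^ 16 := by positivity
    rw [hσ2, add_mul, add_mul]
    have b2 := mul_le_mul_of_nonneg_right a2 ht16.le
    have b3 := mul_le_mul_of_nonneg_right a3 ht16.le
    have e3 : 9 * (t ^ 32 * Real.exp (-t)) = 9 * t ^ 16 * Real.exp (-t) * t ^ 16 := by ring
    linarith

theorem tendsto_blkMain_div : ∃ L : ℝ,
    Tendsto (fun m : ℕ => blkMain m / blkCount m) atTop (𝓝 L) := by
  have h := tendsto_blkCount_div_blkMain.inv₀ (by positivity)
  exact ⟨_, h.congr fun m => by rw [inv_div]⟩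

theorem eventually_blkCount_pos : ∀ᶠ m : ℕ in atTop, (0 : ℝ) < blkCount m := by
  filter_upwards [tendsto_blkCount.eventually_ne (by positivity : π / 8 ≠ 0)] with m hm
  rcases (Nat.cast_nonneg (α := ℝ) (blkCount m)).eq_or_lt with h | h
  · rw [← h, zero_div] at hm; exact absurd rfl hm
  · exact h

theorem tendsto_ncard_notMem (s : ℕ) :
    Tendsto (fun m : ℕ => ({M ∈ blkSet m | Sum.inl s ∉ M}.ncard : ℝ) / blkCount m) atTop (𝓝 0) := by
  rw [← tendsto_add_atTop_iff_nat (s + 1)]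
  have h := (tendsto_blkCount_add_div (s + 1)).const_sub 1
  rw [sub_self] at h
  refine h.congr' ?_
  filter_upwards [(tendsto_add_atTop_nat (s + 1)).eventually eventually_blkCount_pos] with j hj
  have h1 : ({M ∈ blkSet (j + (s + 1)) | Sum.inl s ∉ M}.ncard : ℝ) + blkCount j =
      blkCount (j + (s + 1)) := by exact_mod_cast ncard_notMem j (Sum.inl s)
  rw [← h1] at hj ⊢
  field_simp
  ring

theorem tendsto_ncard_blkBad :
    Tendsto (fun m : ℕ => ((blkBad m).ncard : ℝ) / blkCount m) atTop (𝓝 0) := by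
  obtain ⟨C, hC, hG⟩ := blkGen_mul_exp_le
  obtain ⟨L, hL⟩ := tendsto_blkMain_div
  set t : ℕ → ℝ := fun m => (blkScale m)⁻¹ ^ (1 / 8 : ℝ)
  have ht : Tendsto t atTop atTop := (tendsto_rpow_atTop (by norm_num)).comp
    (tendsto_inv_nhdsGT_zero.comp tendsto_blkScale_within)
  have t1 : Tendsto (fun m => 432 / t m ^ 2 + 2 * (t m ^ 16 * Real.exp (-t m)) +
      9 * (t m ^ 32 * Real.exp (-t m))) atTop (𝓝 0) := by
    have h1 := (tendsto_const_nhds (x := (432 : ℝ))).div_atTop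
      ((tendsto_pow_atTop two_ne_zero).comp ht)
    have h2 := ((Real.tendsto_pow_mul_exp_neg_atTop_nhds_zero 16).comp ht).const_mul 2
    have h3 := ((Real.tendsto_pow_mul_exp_neg_atTop_nhds_zero 32).comp ht).const_mul 9
    simpa using (h1.add h2).add h3
  have t2 := tendsto_finsetSum (Finset.range 3) fun s _ => tendsto_ncard_notMem s
  have t3 := t2.add ((t1.const_mul C).mul hL)
  simp only [Finset.sum_const_zero, mul_zero, zero_mul, add_zero] at t3
  refine squeeze_zero' (Eventually.of_forall fun m => by positivity) ?_ t3
  filter_upwards [eventually_blkScale, ht.eventually_ge_atTop 6, eventually_blkCount_pos]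
    with m hm htm hpos
  have hσ := blkScale_pos hm.1
  have ht8 : t m ^ 8 = (blkScale m)⁻¹ := by
    rw [← Real.rpow_mul_natCast (by positivity)]; norm_num
  obtain ⟨R, S, hR, hσR, hb⟩ := exists_cutoffs htm ht8 (mul_blkScale_sq hm.1)
  rw [← Finset.sum_div, ← mul_div_assoc, ← add_div]
  gcongr
  refine (ncard_blkBad_le m R S).trans ?_
  have h1 := ncard_smallSum_three_le m hR hσ
  have h2 := ncard_smallSum_middle_le m R S hσ hσR
  have h3 := ncard_large_le_exp m S hσ
  have h4 := hG m hm.1 hm.2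
  have hM := blkMain_pos hm.1
  set B := 432 * (blkScale m * R) ^ 3 + (2 / 3) ^ R * Real.exp (S * blkScale m) +
    m * Real.exp (-(S * blkScale m))
  have h5 : B * (blkGen (Real.exp (-blkScale m)) * Real.exp (m * blkScale m)) ≤
      C * (432 / t m ^ 2 + 2 * (t m ^ 16 * Real.exp (-t m)) + 9 * (t m ^ 32 * Real.exp (-t m))) *
        blkMain m := by
    calc _ ≤ B * (C * (blkScale m ^ 2)⁻¹ * blkMain m) := by gcongr
      _ = C * (B * (blkScale m ^ 2)⁻¹) * blkMain m := by ring
      _ ≤ _ := by gcongr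
  simp only [B, add_mul] at h5
  linarith

/-- The cells of a rectangle. -/
def cells (R : Rect) : Finset (ℕ × ℕ) := Finset.Ico R.1 R.2.1 ×ˢ Finset.Ico R.2.2.1 R.2.2.2

theorem mem_cells {R : Rect} {p : ℕ × ℕ} : p ∈ cells R ↔ cellIn R p.1 p.2 := by
  simp only [cells, cellIn, Finset.mem_product, Finset.mem_Ico]
  tauto

theorem sum_area_of_isTiling {m n : ℕ} {T : Finset Rect} (hT : IsTiling m n T) :
    ∑ R ∈ T, (R.2.1 - R.1) * (R.2.2.2 - R.2.2.1) = m * n := by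
  have h1 : T.biUnion cells = Finset.range m ×ˢ Finset.range n := by
    ext p
    rw [Finset.mem_biUnion, Finset.mem_product, Finset.mem_range, Finset.mem_range]
    constructor
    · rintro ⟨R, hR, hp⟩
      have h2 := hT.1 R hR
      have h3 := mem_cells.1 hp
      unfold cellIn at h3
      omega
    · rintro ⟨h2, h3⟩
      obtain ⟨R, hR, -⟩ := hT.2 p.1 h2 p.2 h3
      exact ⟨R, hR.1, mem_cells.2 hR.2⟩
  have h2 : (T : Set Rect).PairwiseDisjoint cells := by
    intro R hR S hS hne
    refine Finset.disjoint_left.2 fun p hpR hpS => hne ?_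
    have h3 : p ∈ T.biUnion cells := Finset.mem_biUnion.2 ⟨R, hR, hpR⟩
    rw [h1, Finset.mem_product, Finset.mem_range, Finset.mem_range] at h3
    exact (hT.2 p.1 h3.1 p.2 h3.2).unique ⟨hR, mem_cells.1 hpR⟩ ⟨hS, mem_cells.1 hpS⟩
  have h3 := Finset.card_biUnion h2
  rw [h1, Finset.card_product, Finset.card_range, Finset.card_range] at h3
  rw [h3]
  exact Finset.sum_congr rfl fun R _ => by simp [cells]

/-- The side lengths of a block of width one or two. -/
def blkPair : ℕ ⊕ ℕ → ℕ × ℕ := Sum.elim (fun k => (1, k + 1)) fun j => (2, j + 2)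

theorem blkPair_injective : Function.Injective blkPair := by
  rintro (k | j) (k' | j') h <;> simp_all [blkPair]

/-- The block multisets of the tilings of `[0,m] × [0,n]`. -/
def tilingBlocks (m n : ℕ) : Set (Multiset (ℕ × ℕ)) := {M | ∃ T, IsTiling m n T ∧ blocksOf T = M}

theorem tilingBlocks_two_subset (n : ℕ) : tilingBlocks 2 n ⊆
    Multiset.map blkPair '' blkSet (2 * n) := by
  rintro _ ⟨T, hT, rfl⟩
  have h : ∀ R ∈ T, ∃ b, blkPair b = blockOf R ∧
      blkArea b = (R.2.1 - R.1) * (R.2.2.2 - R.2.2.1) := by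
    intro R hR
    have h1 := hT.1 R hR
    obtain ⟨d, hd⟩ : ∃ d, R.2.2.2 - R.2.2.1 = d + 1 := ⟨R.2.2.2 - R.2.2.1 - 1, by omega⟩
    unfold blockOf
    rcases (by omega : R.2.1 - R.1 = 1 ∨ R.2.1 - R.1 = 2) with h2 | h2 <;> rw [h2, hd]
    · exact ⟨Sum.inl d, by simp [blkPair], by simp [blkArea]⟩
    · rcases d with _ | d
      · exact ⟨Sum.inl 1, by simp [blkPair], by simp [blkArea]⟩
      · exact ⟨Sum.inr d, by simp [blkPair], by simp [blkArea]⟩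
  choose! f hf1 hf2 using h
  refine ⟨T.val.map f, ?_, ?_⟩
  · rw [blkSet, Set.mem_ofPred_eq, Multiset.map_map, ← sum_area_of_isTiling hT]
    exact Finset.sum_congr rfl hf2
  · rw [Multiset.map_map]
    exact Multiset.map_congr rfl hf1

theorem finite_tilingBlocks_two (n : ℕ) : (tilingBlocks 2 n).Finite :=
  ((finite_blkSet (2 * n)).image _).subset (tilingBlocks_two_subset n)

theorem rectP_eq_ncard (m n : ℕ) : rectP m n = (tilingBlocks m n).ncard := Nat.card_coe_set_eq _

theorem rectP_two_le (n : ℕ) : rectP 2 n ≤ blkCount (2 * n) := by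
  rw [rectP_eq_ncard, ← ncard_blkSet]
  exact (Set.ncard_le_ncard (tilingBlocks_two_subset n) ((finite_blkSet _).image _)).trans
    (Set.ncard_image_le (finite_blkSet _))

/-- A region of cells is tileable with block multiset `M`. -/
def Tileable (X : Set (ℕ × ℕ)) (M : Multiset (ℕ × ℕ)) : Prop :=
  ∃ T : Finset Rect, (∀ R ∈ T, R.1 < R.2.1 ∧ R.2.2.1 < R.2.2.2 ∧ (cells R : Set (ℕ × ℕ)) ⊆ X) ∧
    (∀ p ∈ X, ∃! R, R ∈ T ∧ p ∈ cells R) ∧ blocksOf T = M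

theorem tileable_empty : Tileable ∅ 0 := ⟨∅, by simp, by simp, rfl⟩

theorem tileable_cells {R : Rect} (h1 : R.1 < R.2.1) (h2 : R.2.2.1 < R.2.2.2) :
    Tileable (cells R) {blockOf R} :=
  ⟨{R}, by simpa using ⟨h1, h2⟩, fun p hp => ⟨R, by simpa using hp, by simp⟩, by simp [blocksOf]⟩

theorem Tileable.union {X Y : Set (ℕ × ℕ)} {M N : Multiset (ℕ × ℕ)} (hX : Tileable X M)
    (hY : Tileable Y N) (hXY : Disjoint X Y) : Tileable (X ∪ Y) (M + N) := by
  obtain ⟨T, hT1, hT2, rfl⟩ := hX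
  obtain ⟨U, hU1, hU2, rfl⟩ := hY
  rw [Set.disjoint_left] at hXY
  have hd : Disjoint T U := by
    refine Finset.disjoint_left.2 fun R hRT hRU => ?_
    have hmem : (R.1, R.2.2.1) ∈ cells R := by
      have := hT1 R hRT
      simp [cells, this.1, this.2.1]
    exact hXY ((hT1 R hRT).2.2 hmem) ((hU1 R hRU).2.2 hmem)
  refine ⟨T.disjUnion U hd, fun R hR => ?_, fun p hp => ?_,
    Multiset.map_add blockOf T.val U.val⟩
  · rcases Finset.mem_disjUnion.1 hR with h | h
    · exact ⟨(hT1 R h).1, (hT1 R h).2.1, (hT1 R h).2.2.trans Set.subset_union_left⟩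
    · exact ⟨(hU1 R h).1, (hU1 R h).2.1, (hU1 R h).2.2.trans Set.subset_union_right⟩
  · rcases hp with hp | hp
    · obtain ⟨R, hR, hu⟩ := hT2 p hp
      refine ⟨R, ⟨Finset.mem_disjUnion.2 (Or.inl hR.1), hR.2⟩, fun S hS => ?_⟩
      rcases Finset.mem_disjUnion.1 hS.1 with h | h
      · exact hu S ⟨h, hS.2⟩
      · exact absurd ((hU1 S h).2.2 hS.2) (hXY hp)
    · obtain ⟨R, hR, hu⟩ := hU2 p hp
      refine ⟨R, ⟨Finset.mem_disjUnion.2 (Or.inr hR.1), hR.2⟩, fun S hS => ?_⟩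
      rcases Finset.mem_disjUnion.1 hS.1 with h | h
      · exact absurd hp (hXY ((hT1 S h).2.2 hS.2))
      · exact hu S ⟨h, hS.2⟩

theorem tileable_strip {a b : ℕ} (hab : a < b) {M : Multiset ℕ} (hM : ∀ d ∈ M, 0 < d) (c : ℕ) :
    Tileable (cells (a, b, c, c + M.sum)) (M.map fun d => (min (b - a) d, max (b - a) d)) := by
  induction M using Multiset.induction_on generalizing c with
  | empty => simpa [cells] using tileable_empty
  | cons d M ih =>
    have hd := hM d (Multiset.mem_cons_self _ _)
    have h1 := tileable_cells (R := (a, b, c, c + d)) hab (by simpa)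
    have h2 := ih (fun e he => hM e (Multiset.mem_cons_of_mem he)) (c + d)
    have h3 := h1.union h2 (Set.disjoint_left.2 fun p hp hq => by
      simp only [cells, Finset.mem_coe, Finset.mem_product, Finset.mem_Ico] at hp hq
      omega)
    convert h3 using 1
    · ext p
      simp only [cells, Finset.mem_coe, Finset.mem_product, Finset.mem_Ico, Set.mem_union,
        Multiset.sum_cons]
      omega
    · simp [blockOf]

theorem isTiling_of_tileable {m n : ℕ} {M : Multiset (ℕ × ℕ)}
    (h : Tileable (cells (0, m, 0, n)) M) :
    M ∈ tilingBlocks m n := by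
  obtain ⟨T, h1, h2, h3⟩ := h
  refine ⟨T, ⟨fun R hR => ?_, fun i hi j hj => ?_⟩, h3⟩
  · obtain ⟨h4, h5, h6⟩ := h1 R hR
    have h7 : (R.2.1 - 1, R.2.2.2 - 1) ∈ cells R := by
      simp only [cells, Finset.mem_product, Finset.mem_Ico]
      omega
    have h8 := h6 h7
    simp only [cells, Finset.mem_coe, Finset.mem_product, Finset.mem_Ico] at h8
    omega
  · have h4 := h2 (i, j) (by simp [cells, hi, hj])
    simpa only [mem_cells] using h4

theorem exists_le_sum_eq (M : Multiset ℕ)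
    (hM : ∀ k ∈ M, k ≤ (M.map fun i => if i < k then i + 1 else 0).sum) {h : ℕ}
    (hh : h ≤ (M.map (· + 1)).sum) : ∃ A ≤ M, (A.map (· + 1)).sum = h := by
  induction M using Multiset.strongInductionOn generalizing h with
  | ih M ih =>
    rcases eq_or_ne M 0 with rfl | h0
    · exact ⟨0, le_rfl, by simpa using hh.antisymm' (Nat.zero_le _)⟩
    obtain ⟨p, hp, hmax⟩ := M.toFinset.exists_max_image id (by simpa using h0)
    simp only [Multiset.mem_toFinset, id] at hp hmax
    obtain ⟨N, rfl⟩ := Multiset.exists_cons_of_mem hp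
    have hN : ∀ k ∈ N, k ≤ (N.map fun i => if i < k then i + 1 else 0).sum := fun k hk => by
      have h1 := hM k (Multiset.mem_cons_of_mem hk)
      have h2 := hmax k (Multiset.mem_cons_of_mem hk)
      rwa [Multiset.map_cons, Multiset.sum_cons, if_neg (by omega), zero_add] at h1
    have hp1 : p ≤ (N.map (· + 1)).sum := by
      have h1 := hM p hp
      rw [Multiset.map_cons, Multiset.sum_cons, if_neg (lt_irrefl p), zero_add] at h1
      refine h1.trans (Multiset.sum_map_le_sum_map _ _ fun i _ => ?_)
      split_ifs <;> omega
    rw [Multiset.map_cons, Multiset.sum_cons] at hh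
    rcases le_or_gt h (N.map (· + 1)).sum with hle | hlt
    · obtain ⟨A, hA, hs⟩ := ih N (Multiset.lt_cons_self N p) hN hle
      exact ⟨A, hA.trans (Multiset.le_cons_self N p), hs⟩
    · obtain ⟨A, hA, hs⟩ := ih N (Multiset.lt_cons_self N p) hN (h := h - (p + 1)) (by omega)
      refine ⟨p ::ₘ A, Multiset.cons_le_cons p hA, ?_⟩
      rw [Multiset.map_cons, Multiset.sum_cons, hs]
      omega

theorem exists_eq_map_inl_add_map_inr (M : Multiset (ℕ ⊕ ℕ)) :
    ∃ A B : Multiset ℕ, M = A.map Sum.inl + B.map Sum.inr := by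
  induction M using Multiset.induction_on with
  | empty => exact ⟨0, 0, rfl⟩
  | cons b M ih =>
    obtain ⟨A, B, rfl⟩ := ih
    rcases b with k | j
    · exact ⟨k ::ₘ A, B, by simp⟩
    · exact ⟨A, j ::ₘ B, by simp⟩

theorem map_blkPair_mem_tilingBlocks {n : ℕ} {M : Multiset (ℕ ⊕ ℕ)} (hM : M ∈ blkSet (2 * n))
    (hgood : ∀ k, Sum.inl k ∈ M → k ≤ smallSum k M) : M.map blkPair ∈ tilingBlocks 2 n := by
  obtain ⟨P, Q, rfl⟩ := exists_eq_map_inl_add_map_inr M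
  have harea : (P.map (· + 1)).sum + 2 * (Q.map (· + 2)).sum = 2 * n := by
    rw [← Multiset.sum_map_mul_left]
    simpa [blkSet, blkArea, Function.comp_def] using hM
  obtain ⟨A, hA, hsum⟩ := exists_le_sum_eq P (fun k hk => by
    simpa [smallSum, smallLength, Function.comp_def] using hgood k (by simpa using hk))
    (h := (P.map (· + 1)).sum / 2) (by omega)
  obtain ⟨B, rfl⟩ := Multiset.le_iff_exists_add.1 hA
  set h := ((A + B).map (· + 1)).sum / 2 with hh
  have hB : (B.map (· + 1)).sum = h := by
    rw [Multiset.map_add, Multiset.sum_add] at hh harea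
    omega
  have t1 := tileable_strip (a := 0) (b := 1) one_pos (M := A.map (· + 1)) (by simp) 0
  have t2 := tileable_strip (a := 1) (b := 2) one_lt_two (M := B.map (· + 1)) (by simp) 0
  have t3 := tileable_strip (a := 0) (b := 2) two_pos (M := Q.map (· + 2)) (by simp) h
  rw [hsum] at t1
  rw [hB] at t2
  have hn : h + (Q.map (· + 2)).sum = n := by
    rw [Multiset.map_add, Multiset.sum_add] at harea
    omega
  rw [hn] at t3
  have t := (t1.union t2 (Set.disjoint_left.2 fun p hp hq => by
    simp only [cells, Finset.mem_coe, Finset.mem_product, Finset.mem_Ico] at hp hq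
    omega)).union t3 (Set.disjoint_left.2 fun p hp hq => by
    simp only [cells, Finset.mem_coe, Finset.mem_product, Finset.mem_Ico, Set.mem_union] at hp hq
    omega)
  refine isTiling_of_tileable ?_
  convert t using 1
  · ext p
    simp only [cells, Finset.mem_coe, Finset.mem_product, Finset.mem_Ico, Set.mem_union]
    omega
  · simp [blkPair, Function.comp_def]

theorem blkCount_le_rectP_two_add (n : ℕ) :
    blkCount (2 * n) ≤ rectP 2 n + (blkBad (2 * n)).ncard := by
  have hsub : Multiset.map blkPair '' (blkSet (2 * n) \ blkBad (2 * n)) ⊆ tilingBlocks 2 n := by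
    rintro _ ⟨M, ⟨hM, hbad⟩, rfl⟩
    refine map_blkPair_mem_tilingBlocks hM fun k hk => ?_
    by_contra! h
    exact hbad ⟨hM, k, hk, h⟩
  have h1 := Set.ncard_le_ncard hsub (finite_tilingBlocks_two n)
  rw [Set.ncard_image_of_injective _ (Multiset.map_injective blkPair_injective),
    ← rectP_eq_ncard] at h1
  have h2 := Set.ncard_le_ncard_sdiff_add_ncard (blkSet (2 * n)) (blkBad (2 * n))
    ((finite_blkSet _).subset fun M h => h.1)
  rw [ncard_blkSet] at h2
  omega

/-- As `n → ∞`, `p(2,n) ~ (π·2^{1/4}/32) · n^{-7/4} · exp(π√(2n))`. -/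
theorem rectP_two_asymptotic :
    Filter.Tendsto (fun n : ℕ =>
      (rectP 2 n : ℝ) /
        ((Real.pi * (2 : ℝ) ^ ((1 : ℝ) / 4) / 32) * (n : ℝ) ^ (-(7 : ℝ) / 4) *
          Real.exp (Real.pi * Real.sqrt (2 * n))))
      Filter.atTop (nhds 1) := by
  have hmul : Tendsto (fun n : ℕ => 2 * n) atTop atTop :=
    tendsto_id.const_mul_atTop' two_pos
  have h1 := tendsto_ncard_blkBad.comp hmul
  have h2 : Tendsto (fun n : ℕ => (rectP 2 n : ℝ) / blkCount (2 * n)) atTop (𝓝 1) := by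
    have h3 := h1.const_sub 1
    rw [sub_zero] at h3
    refine tendsto_of_tendsto_of_tendsto_of_le_of_le' h3 tendsto_const_nhds ?_ ?_ <;>
      filter_upwards [hmul.eventually eventually_blkCount_pos] with n hn
    · have h4 : (blkCount (2 * n) : ℝ) ≤ rectP 2 n + (blkBad (2 * n)).ncard := by
        exact_mod_cast blkCount_le_rectP_two_add n
      rw [Function.comp_apply, sub_le_iff_le_add, ← add_div, le_div_iff₀ hn, one_mul]
      exact h4
    · rw [div_le_one hn]
      exact_mod_cast rectP_two_le n
  have h3 := (tendsto_blkCount.comp hmul).div_const (π / 8)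
  rw [div_self (by positivity)] at h3
  have h4 := h2.mul h3
  rw [mul_one] at h4
  refine h4.congr' ?_
  filter_upwards [hmul.eventually eventually_blkCount_pos, eventually_gt_atTop 0] with n hn hn0
  have hpow : (2 : ℝ) ^ (-(7 : ℝ) / 4) * (π / 8) = π * (2 : ℝ) ^ ((1 : ℝ) / 4) / 32 := by
    have : (2 : ℝ) ^ ((1 : ℝ) / 4) = 2 ^ (-(7 : ℝ) / 4) * 2 ^ (2 : ℕ) := by
      rw [← Real.rpow_natCast, ← Real.rpow_add two_pos]; norm_num
    rw [this]; ring
  rw [Function.comp_apply, ← hpow]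
  push_cast
  rw [Real.mul_rpow two_pos.le (Nat.cast_nonneg n)]
  have hn1 : (0 : ℝ) < (n : ℝ) ^ (-(7 : ℝ) / 4) := Real.rpow_pos_of_pos (by exact_mod_cast hn0) _
  field_simp
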